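/- Let 𝕊_L = {y/x : (x,y) ∈ Λ, x > 0, 0 ≤ y ≤ x ≤ L} for L ≥ 1. Then each 𝕊_L is a finite set; write its elements in increasing order as s_L^{(0)} < s_L^{(1)} < … < s_L^{(N(L)−1)}, where N(L) = |𝕊_L|. For every t ≥ 0, lim_{L→∞} (1/N(L)) · #{ i : 0 ≤ i < N(L)−1 and L²(s_L^{(i+1)} − s_L^{(i)}) ≥ t } = m({(a,b) ∈ Ω : R(a,b) ≥ t}). -/

import Mathlib

open Matrix MeasureTheory Filter Topology

noncomputable section

abbrev SL2 := Matrix.SpecialLinearGroup (Fin 2) ℝ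

/-- The golden ratio φ = (1+√5)/2. -/
def phi : ℝ := (1 + Real.sqrt 5) / 2

/-- φ̄ = 1/φ. -/
def phib : ℝ := phi⁻¹

/-- S = [[0,−1],[1,0]]. -/
def Smat : SL2 := ⟨!![0, -1; 1, 0], by norm_num [Matrix.det_fin_two_of]⟩

/-- P = [[1,φ],[0,1]]. -/
def Pmat : SL2 := ⟨!![1, phi; 0, 1], by norm_num [Matrix.det_fin_two_of]⟩

/-- The Veech group of the golden L: the subgroup generated by S and P. -/
def Γ : Subgroup SL2 := Subgroup.closure {Smat, Pmat}

/-- Linear action of a 2×2 matrix on ℝ². -/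
def mact (g : Matrix (Fin 2) (Fin 2) ℝ) (v : ℝ × ℝ) : ℝ × ℝ :=
  (g 0 0 * v.1 + g 0 1 * v.2, g 1 0 * v.1 + g 1 1 * v.2)

/-- Λ = Γ·(1,0)ᵀ. -/
def Λ : Set (ℝ × ℝ) := {v | ∃ γ ∈ Γ, v = mact (γ : Matrix (Fin 2) (Fin 2) ℝ) (1, 0)}

/-- g_{a,b} = [[a,b],[0,1/a]]. -/
def gab (a b : ℝ) : Matrix (Fin 2) (Fin 2) ℝ := !![a, b; 0, a⁻¹]

/-- h_s = [[1,0],[−s,1]]. -/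
def hmat (s : ℝ) : Matrix (Fin 2) (Fin 2) ℝ := !![1, 0; -s, 1]

/-- Ω = {(a,b) : 0 < a ≤ 1, 1 − aφ < b ≤ 1}. -/
def Ω : Set (ℝ × ℝ) := {p | 0 < p.1 ∧ p.1 ≤ 1 ∧ 1 - p.1 * phi < p.2 ∧ p.2 ≤ 1}

/-- Ω₁ = {(a,b) ∈ Ω : φ̄ ≤ a ≤ 1, 1 − aφ < b ≤ φ̄ − a}. -/
def Ω₁ : Set (ℝ × ℝ) :=
  {p | p ∈ Ω ∧ phib ≤ p.1 ∧ p.1 ≤ 1 ∧ 1 - p.1 * phi < p.2 ∧ p.2 ≤ phib - p.1}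

/-- Ω_φ = {(a,b) ∈ Ω : φ̄² ≤ a ≤ 1, φ̄ − a < b ≤ φ̄ − aφ̄}. -/
def Ωphi : Set (ℝ × ℝ) :=
  {p | p ∈ Ω ∧ phib ^ 2 ≤ p.1 ∧ p.1 ≤ 1 ∧ phib - p.1 < p.2 ∧ p.2 ≤ phib - p.1 * phib}

/-- Ω_∞ = {(a,b) ∈ Ω : φ̄ − aφ̄ < b ≤ 1}. -/
def Ωinf : Set (ℝ × ℝ) := {p | p ∈ Ω ∧ phib - p.1 * phib < p.2 ∧ p.2 ≤ 1}

-- The return time function R.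
open Classical in
noncomputable def Rfun (p : ℝ × ℝ) : ℝ :=
  if p ∈ Ω₁ then 1 / (p.1 * (p.1 + p.2))
  else if p ∈ Ωphi then 1 / (p.1 * (p.1 * phib + p.2))
  else 1 / (p.1 * p.2)

/-- The probability measure m with dm = (2/φ) da db on Ω. -/
noncomputable def m : Measure (ℝ × ℝ) := ENNReal.ofReal (2 / phi) • volume.restrict Ω

-- The golden-L BCZ map T.
open Classical in
noncomputable def Tmap (p : ℝ × ℝ) : ℝ × ℝ :=
  if p ∈ Ω₁ then
    ((p.1 + p.2) * phi,
      p.1 + p.2 * phi +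
        (-(⌊(p.1 + p.2 * phi - 1) / (phi ^ 2 * (p.1 + p.2))⌋ : ℤ) : ℝ) * phi ^ 2 * (p.1 + p.2))
  else if p ∈ Ωphi then
    (p.1 + p.2 * phi,
      p.2 + (-(⌊(p.2 - 1) / (phi * (p.1 + p.2 * phi))⌋ : ℤ) : ℝ) * phi * (p.1 + p.2 * phi))
  else
    (p.2, -p.1 + (-(⌊(-p.1 - 1) / (phi * p.2)⌋ : ℤ) : ℝ) * phi * p.2)

/-- 𝕊_L: slopes y/x of vectors (x,y) ∈ Λ with x > 0 and 0 ≤ y ≤ x ≤ L. -/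
def SLset (L : ℝ) : Set ℝ :=
  {s | ∃ v ∈ Λ, 0 < v.1 ∧ 0 ≤ v.2 ∧ v.2 ≤ v.1 ∧ v.1 ≤ L ∧ s = v.2 / v.1}

lemma phi_sq : phi ^ 2 = phi + 1 := by
  have h : Real.sqrt 5 ^ 2 = 5 := Real.sq_sqrt (by norm_num)
  unfold phi
  linear_combination h / 4

lemma phi_gt : 1.6 < phi := by
  have h : (2.2 : ℝ) < Real.sqrt 5 := Real.lt_sqrt_of_sq_lt (by norm_num)
  unfold phi
  linarith

lemma phi_lt : phi < 1.7 := by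
  have h : Real.sqrt 5 < 2.4 := (Real.sqrt_lt' (by norm_num)).2 (by norm_num)
  unfold phi
  linarith

lemma phi_pos : 0 < phi := by linarith [phi_gt]

lemma phib_eq : phib = phi - 1 := by
  unfold phib
  have h := phi_sq
  have h0 := phi_pos
  field_simp
  linarith

/-- The first-quadrant vectors of the orbit `Λ`, generated by the golden analogue of the
Stern–Brocot tree. -/
inductive QuadVec : ℝ → ℝ → Prop
  | e1 : QuadVec 1 0
  | e2 : QuadVec 0 1
  | m1 {p q : ℝ} : QuadVec p q → QuadVec (p + phi * q) q
  | m2 {p q : ℝ} : QuadVec p q → QuadVec (phi * p + phi * q) (p + phi * q)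
  | m3 {p q : ℝ} : QuadVec p q → QuadVec (phi * p + q) (phi * p + phi * q)
  | m4 {p q : ℝ} : QuadVec p q → QuadVec p (phi * p + q)

namespace QuadVec

lemma coords {p q : ℝ} (h : QuadVec p q) :
    (p = 0 ∧ q = 1) ∨ (1 ≤ p ∧ (q = 0 → p = 1) ∧ (q = 0 ∨ 1 ≤ q)) := by
  have := phi_gt
  induction h with
  | e1 => norm_num
  | e2 => norm_num
  | m1 h ih =>
    rcases ih with ⟨rfl, rfl⟩ | ⟨h1, h2, rfl | h3⟩
    · right; norm_num; linarith
    · simp at h2; right; subst h2; norm_num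
    · right; refine ⟨by nlinarith, fun h => by linarith, Or.inr h3⟩
  | m2 h ih =>
    rcases ih with ⟨rfl, rfl⟩ | ⟨h1, h2, rfl | h3⟩
    · right; norm_num; refine ⟨by linarith, ?_, Or.inr (by linarith)⟩; intro h; linarith
    · right; simp at h2; subst h2; norm_num; linarith
    · right; refine ⟨by nlinarith, fun h => by nlinarith, Or.inr (by nlinarith)⟩
  | m3 h ih =>
    rcases ih with ⟨rfl, rfl⟩ | ⟨h1, h2, rfl | h3⟩
    · right; norm_num; right; linarith
    · right; simp at h2; subst h2; norm_num; refine ⟨by linarith, fun h => by linarith, Or.inr (by linarith)⟩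
    · right; refine ⟨by nlinarith, fun h => by nlinarith, Or.inr (by nlinarith)⟩
  | m4 h ih =>
    rcases ih with ⟨rfl, rfl⟩ | ⟨h1, h2, rfl | h3⟩
    · left; norm_num
    · right; simp at h2; subst h2; norm_num; refine Or.inr (by linarith)
    · right; refine ⟨by nlinarith, fun h => by nlinarith, Or.inr (by nlinarith)⟩

lemma fst_cases {p q : ℝ} (h : QuadVec p q) : p = 0 ∨ 1 ≤ p := by
  rcases h.coords with ⟨h, _⟩ | ⟨h, _⟩ <;> simp [h]

lemma snd_cases {p q : ℝ} (h : QuadVec p q) : q = 0 ∨ 1 ≤ q := by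
  rcases h.coords with ⟨_, h⟩ | ⟨_, _, h⟩
  · right; exact h.ge
  · exact h

lemma fst_nonneg {p q : ℝ} (h : QuadVec p q) : 0 ≤ p := by
  rcases h.fst_cases with h | h <;> linarith

lemma snd_nonneg {p q : ℝ} (h : QuadVec p q) : 0 ≤ q := by
  rcases h.snd_cases with h | h <;> linarith

lemma one_le_add {p q : ℝ} (h : QuadVec p q) : 1 ≤ p + q := by
  have := h.snd_nonneg
  rcases h.coords with ⟨h, _⟩ | ⟨h, _⟩ <;> linarith

end QuadVec

/-- The union of the four rotations of the first-quadrant vectors. -/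
def RotVec (p q : ℝ) : Prop :=
  QuadVec p q ∨ QuadVec (-p) (-q) ∨ QuadVec q (-p) ∨ QuadVec (-q) p

lemma RotVec.rot {p q : ℝ} (h : RotVec p q) : RotVec (-q) p := by
  unfold RotVec at *
  simp only [neg_neg]
  tauto

lemma RotVec.neg {p q : ℝ} (h : RotVec p q) : RotVec (-p) (-q) := h.rot.rot

lemma QuadVec.congr {p q p' q' : ℝ} (h : QuadVec p q) (h1 : p' = p) (h2 : q' = q) :
    QuadVec p' q' := by subst h1 h2; exact h

lemma RotVec.congr {p q p' q' : ℝ} (h : RotVec p q) (h1 : p' = p) (h2 : q' = q) :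
    RotVec p' q' := by subst h1 h2; exact h

lemma QuadVec.rotVec {p q : ℝ} (h : QuadVec p q) : RotVec p q := Or.inl h

/-- `P S v` for `v` in the first quadrant. -/
lemma QuadVec.shear_rot {p q : ℝ} (h : QuadVec p q) : RotVec (-q + phi * p) p := by
  have hp := phi_sq
  cases h with
  | e1 => exact (QuadVec.e2.m1).rotVec.congr (by ring) (by ring)
  | e2 => exact (QuadVec.e1).rotVec.neg.congr (by ring) (by ring)
  | @m1 p q h => exact h.m2.rotVec.congr (by linear_combination q * hp) (by ring)
  | @m2 p q h => exact h.m3.rotVec.congr (by linear_combination (p + q) * hp) (by ring)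
  | @m3 p q h => exact h.m4.rotVec.congr (by linear_combination p * hp) (by ring)
  | m4 h => exact h.rotVec.rot.congr (by ring) (by ring)

lemma RotVec.shear {p q : ℝ} (h : RotVec p q) : RotVec (p + phi * q) q := by
  rcases h with h | h | h | h
  · exact h.m1.rotVec
  · exact h.m1.rotVec.neg.congr (by ring) (by ring)
  · exact h.shear_rot.congr (by ring) (by ring)
  · exact h.shear_rot.neg.congr (by ring) (by ring)

lemma QuadVec.unshear {p q : ℝ} (h : QuadVec p q) : RotVec (p - phi * q) q := by
  have hp := phi_sq
  cases h with
  | e1 => exact QuadVec.e1.rotVec.congr (by ring) (by ring)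
  | e2 => exact (QuadVec.e1.m4.rotVec.rot).congr (by ring) (by ring)
  | m1 h => exact h.rotVec.congr (by ring) (by ring)
  | @m2 p q h => exact h.m1.rotVec.rot.congr (by linear_combination (-q) * hp) (by ring)
  | @m3 p q h => exact h.m2.rotVec.rot.congr (by linear_combination (-p - q) * hp) (by ring)
  | @m4 p q h => exact h.m3.rotVec.rot.congr (by linear_combination (-p) * hp) (by ring)

lemma RotVec.unshear {p q : ℝ} (h : RotVec p q) : RotVec (p - phi * q) q := by
  rcases h with h | h | h | h
  · exact h.unshear
  · exact h.unshear.neg.congr (by ring) (by ring)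
  · exact h.m4.rotVec.rot.congr (by ring) (by ring)
  · exact h.m4.rotVec.rot.neg.congr (by ring) (by ring)

lemma rotVec_smat_iff (v : ℝ × ℝ) :
    RotVec (mact Smat.1 v).1 (mact Smat.1 v).2 ↔ RotVec v.1 v.2 := by
  simp only [mact, Smat]
  simp
  exact ⟨fun h => h.rot.rot.rot.congr (by ring) (by ring), fun h => h.rot⟩

lemma rotVec_pmat_iff (v : ℝ × ℝ) :
    RotVec (mact Pmat.1 v).1 (mact Pmat.1 v).2 ↔ RotVec v.1 v.2 := by
  simp only [mact, Pmat]
  simp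
  exact ⟨fun h => h.unshear.congr (by ring) (by ring), fun h => h.shear⟩

lemma mact_mul (A B : Matrix (Fin 2) (Fin 2) ℝ) (v : ℝ × ℝ) :
    mact (A * B) v = mact A (mact B v) := by
  simp only [mact, Matrix.mul_apply, Fin.sum_univ_two, Prod.mk.injEq]
  constructor <;> ring

lemma mact_one (v : ℝ × ℝ) : mact 1 v = v := by simp [mact]

lemma rotVec_gamma_iff {γ : SL2} (hγ : γ ∈ Γ) :
    ∀ v : ℝ × ℝ, RotVec (mact γ.1 v).1 (mact γ.1 v).2 ↔ RotVec v.1 v.2 := by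
  unfold Γ at hγ
  induction hγ using Subgroup.closure_induction with
  | mem x hx =>
    rcases hx with rfl | rfl
    · exact rotVec_smat_iff
    · exact rotVec_pmat_iff
  | one => intro v; simp [mact_one]
  | mul x y _ _ hx hy =>
    intro v
    rw [Matrix.SpecialLinearGroup.coe_mul, mact_mul, hx, hy]
  | inv x _ hx =>
    intro v
    rw [← hx, ← mact_mul, ← Matrix.SpecialLinearGroup.coe_mul, mul_inv_cancel]
    simp [mact_one]

lemma rotVec_of_mem {v : ℝ × ℝ} (hv : v ∈ Λ) : RotVec v.1 v.2 := by
  obtain ⟨γ, hγ, rfl⟩ := hv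
  exact (rotVec_gamma_iff hγ (1, 0)).2 QuadVec.e1.rotVec

lemma mact_mem {γ : SL2} (hγ : γ ∈ Γ) {v : ℝ × ℝ} (hv : v ∈ Λ) : mact γ.1 v ∈ Λ := by
  obtain ⟨δ, hδ, rfl⟩ := hv
  exact ⟨γ * δ, mul_mem hγ hδ, by rw [Matrix.SpecialLinearGroup.coe_mul, mact_mul]⟩

lemma smat_mem : Smat ∈ Γ := Subgroup.subset_closure (by simp)
lemma pmat_mem : Pmat ∈ Γ := Subgroup.subset_closure (by simp)

lemma rot_mem {p q : ℝ} (h : (p, q) ∈ Λ) : (-q, p) ∈ Λ := by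
  have := mact_mem smat_mem h
  simpa [mact, Smat] using this

lemma neg_mem_orbit {p q : ℝ} (h : (p, q) ∈ Λ) : (-p, -q) ∈ Λ := rot_mem (rot_mem h)

lemma shear_mem {p q : ℝ} (h : (p, q) ∈ Λ) : (p + phi * q, q) ∈ Λ := by
  have := mact_mem pmat_mem h
  simpa [mact, Pmat] using this

lemma e1_mem : ((1 : ℝ), (0 : ℝ)) ∈ Λ := ⟨1, one_mem _, by simp [mact]⟩

lemma orbit_congr {p q p' q' : ℝ} (h : (p, q) ∈ Λ) (h1 : p' = p) (h2 : q' = q) : (p', q') ∈ Λ := by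
  subst h1 h2; exact h

lemma quadVec_mem {p q : ℝ} (h : QuadVec p q) : (p, q) ∈ Λ := by
  have hp := phi_sq
  have key : ∀ {p q : ℝ}, (p, q) ∈ Λ → (-q + phi * p, p) ∈ Λ := fun h => shear_mem (rot_mem h)
  have h2 : ∀ {p q : ℝ}, (p, q) ∈ Λ → (phi * p + phi * q, p + phi * q) ∈ Λ := fun {p q} h =>
    orbit_congr (key (shear_mem h)) (by linear_combination (-q) * hp) (by ring)
  have h3 : ∀ {p q : ℝ}, (p, q) ∈ Λ → (phi * p + q, phi * p + phi * q) ∈ Λ := fun {p q} h =>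
    orbit_congr (key (h2 h)) (by linear_combination (-p - q) * hp) (by ring)
  induction h with
  | e1 => exact e1_mem
  | e2 => exact orbit_congr (rot_mem e1_mem) (by ring) (by ring)
  | m1 h ih => exact shear_mem ih
  | m2 h ih => exact h2 ih
  | m3 h ih => exact h3 ih
  | @m4 p q h ih =>
    exact orbit_congr (key (h3 ih)) (by linear_combination (-p) * hp) (by ring)

lemma mem_iff_rotVec {p q : ℝ} : (p, q) ∈ Λ ↔ RotVec p q := by
  refine ⟨fun h => rotVec_of_mem h, ?_⟩
  rintro (h | h | h | h)
  · exact quadVec_mem h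
  · exact orbit_congr (neg_mem_orbit (quadVec_mem h)) (by ring) (by ring)
  · exact orbit_congr (rot_mem (quadVec_mem h)) (by ring) (by ring)
  · exact orbit_congr (neg_mem_orbit (rot_mem (quadVec_mem h))) (by ring) (by ring)

lemma orbit_fst {p q : ℝ} (h : (p, q) ∈ Λ) : p = 0 ∨ 1 ≤ |p| := by
  have key : ∀ x : ℝ, x = 0 ∨ 1 ≤ x → x = 0 ∨ 1 ≤ |x| := fun x hx =>
    hx.imp id fun h => h.trans (le_abs_self x)
  rcases mem_iff_rotVec.1 h with h | h | h | h
  · exact key _ h.fst_cases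
  · simpa using key _ h.fst_cases
  · simpa using key _ h.snd_cases
  · exact key _ h.snd_cases

lemma orbit_snd {p q : ℝ} (h : (p, q) ∈ Λ) : q = 0 ∨ 1 ≤ |q| := by
  simpa using orbit_fst (rot_mem h)

lemma QuadVec.snd_eq_zero {p : ℝ} (h : QuadVec p 0) : p = 1 := by
  rcases h.coords with ⟨_, h⟩ | ⟨_, h, _⟩
  · norm_num at h
  · exact h rfl

lemma QuadVec.swap {p q : ℝ} (h : QuadVec p q) : QuadVec q p := by
  induction h with
  | e1 => exact .e2
  | e2 => exact .e1
  | m1 h ih => exact ih.m4.congr (by ring) (by ring)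
  | m2 h ih => exact ih.m3.congr (by ring) (by ring)
  | m3 h ih => exact ih.m2.congr (by ring) (by ring)
  | m4 h ih => exact ih.m1.congr (by ring) (by ring)

lemma QuadVec.fst_eq_zero {q : ℝ} (h : QuadVec 0 q) : q = 1 := h.swap.snd_eq_zero

lemma orbit_snd_zero {p : ℝ} (h : (p, (0 : ℝ)) ∈ Λ) : p = 1 ∨ p = -1 := by
  rcases mem_iff_rotVec.1 h with h | h | h | h
  · exact Or.inl h.snd_eq_zero
  · rw [neg_zero] at h; right; linarith [h.snd_eq_zero]
  · right; linarith [h.fst_eq_zero]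
  · rw [neg_zero] at h; exact Or.inl h.fst_eq_zero

lemma quadVec_of_nonneg {p q : ℝ} (h : (p, q) ∈ Λ) (hp : 0 ≤ p) (hq : 0 ≤ q) : QuadVec p q := by
  rcases mem_iff_rotVec.1 h with h | h | h | h
  · exact h
  · linarith [h.one_le_add]
  · have hp0 : p = 0 := le_antisymm (by linarith [h.snd_nonneg]) hp
    subst hp0
    rw [neg_zero] at h
    rw [h.snd_eq_zero]; exact .e2
  · have hq0 : q = 0 := le_antisymm (by linarith [h.fst_nonneg]) hq
    subst hq0
    rw [neg_zero] at h
    rw [h.fst_eq_zero]; exact .e1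

lemma reflect_mem {p q : ℝ} (h : (p, q) ∈ Λ) : (p, -q) ∈ Λ := by
  rw [mem_iff_rotVec] at *
  unfold RotVec at *
  rw [neg_neg]
  rcases h with h | h | h | h <;> have := h.swap <;> tauto

/-- The entries of an element of the group, with its determinant relation. -/
lemma sl2_det (g : SL2) : g.1 0 0 * g.1 1 1 - g.1 0 1 * g.1 1 0 = 1 := by
  have := g.2
  rwa [Matrix.det_fin_two] at this

lemma sl2_mul (g h : SL2) (i j : Fin 2) :
    (g * h).1 i j = g.1 i 0 * h.1 0 j + g.1 i 1 * h.1 1 j := by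
  rw [Matrix.SpecialLinearGroup.coe_mul, Matrix.mul_apply, Fin.sum_univ_two]

lemma sl2_inv (g : SL2) : (g⁻¹).1 0 0 = g.1 1 1 ∧ (g⁻¹).1 0 1 = - g.1 0 1 ∧
    (g⁻¹).1 1 0 = - g.1 1 0 ∧ (g⁻¹).1 1 1 = g.1 0 0 := by
  rw [Matrix.SpecialLinearGroup.coe_inv, Matrix.adjugate_fin_two]
  simp

lemma sl2_ext {g h : SL2} (h00 : g.1 0 0 = h.1 0 0) (h01 : g.1 0 1 = h.1 0 1)
    (h10 : g.1 1 0 = h.1 1 0) (h11 : g.1 1 1 = h.1 1 1) : g = h := by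
  ext i j
  fin_cases i <;> fin_cases j <;> assumption

lemma col_one_mem {γ : SL2} (h : γ ∈ Γ) : (γ.1 0 0, γ.1 1 0) ∈ Λ :=
  ⟨γ, h, by simp [mact]⟩

lemma col_two_mem {γ : SL2} (h : γ ∈ Γ) : (γ.1 0 1, γ.1 1 1) ∈ Λ := by
  have := mact_mem h (rot_mem e1_mem)
  simpa [mact] using this

lemma exists_col {p q : ℝ} (h : (p, q) ∈ Λ) : ∃ γ ∈ Γ, γ.1 0 0 = p ∧ γ.1 1 0 = q := by
  obtain ⟨γ, hγ, h⟩ := h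
  refine ⟨γ, hγ, ?_, ?_⟩ <;> simp [mact] at h <;> simp [h]

lemma pmat_zpow (k : ℤ) : (Pmat ^ k).1 0 0 = 1 ∧ (Pmat ^ k).1 0 1 = k * phi ∧
    (Pmat ^ k).1 1 0 = 0 ∧ (Pmat ^ k).1 1 1 = 1 := by
  induction k using Int.induction_on with
  | zero => simp
  | succ k ih =>
    rw [_root_.zpow_add_one]
    simp only [sl2_mul, ih]
    simp [Pmat]; ring
  | pred k ih =>
    rw [_root_.zpow_sub_one]
    simp only [sl2_mul, ih, sl2_inv]
    simp [Pmat]; ring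

lemma pmat_zpow_mem (k : ℤ) : Pmat ^ k ∈ Γ := zpow_mem pmat_mem k

lemma shear_zpow_mem {p q : ℝ} (h : (p, q) ∈ Λ) (k : ℤ) : (p + k * phi * q, q) ∈ Λ := by
  have := mact_mem (pmat_zpow_mem k) h
  simpa [mact, pmat_zpow] using this

lemma QuadVec.snd_one {p q : ℝ} (h : QuadVec p q) (hq : q = 1) (hp : p < phi) : p = 0 := by
  have := phi_gt
  cases h with
  | e1 => norm_num at hq
  | e2 => rfl
  | m1 h => subst hq; linarith [h.fst_nonneg]
  | m2 h =>
    rcases h.snd_cases with h1 | h1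
    · subst h1; simp at hq; subst hq; simp at hp
    · nlinarith [h.fst_nonneg]
  | m3 h => nlinarith [h.one_le_add]
  | m4 h =>
    rcases h.fst_cases with h1 | h1
    · exact h1
    · nlinarith [h.snd_nonneg]

lemma exists_zmul_of_snd_one {x : ℝ} (h : (x, (1 : ℝ)) ∈ Λ) : ∃ k : ℤ, x = k * phi := by
  have h0 := phi_pos
  refine ⟨⌊x / phi⌋, ?_⟩
  have h1 := shear_zpow_mem h (-⌊x / phi⌋)
  have hl : (⌊x / phi⌋ : ℝ) * phi ≤ x := (le_div_iff₀ h0).1 (Int.floor_le _)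
  have hu : x < ((⌊x / phi⌋ : ℝ) + 1) * phi := (div_lt_iff₀ h0).1 (Int.lt_floor_add_one _)
  push_cast at h1
  have := (quadVec_of_nonneg h1 (by linarith) (by norm_num)).snd_one rfl (by linarith)
  linarith

lemma eq_pmat_zpow {γ : SL2} (hγ : γ ∈ Γ) (h0 : γ.1 0 0 = 1) (h1 : γ.1 1 0 = 0) :
    ∃ k : ℤ, γ = Pmat ^ k := by
  have hd := sl2_det γ
  rw [h0, h1] at hd
  have h11 : γ.1 1 1 = 1 := by linarith
  have := col_two_mem hγ
  rw [h11] at this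
  obtain ⟨k, hk⟩ := exists_zmul_of_snd_one this
  refine ⟨k, sl2_ext ?_ ?_ ?_ ?_⟩ <;> simp [pmat_zpow, *]

/-! ### The return time function and consecutive slopes -/

lemma phib_bounds : 0.6 < phib ∧ phib < 0.7 := by
  rw [phib_eq]; constructor <;> linarith [phi_gt, phi_lt]

lemma phi_mul_phib : phi * phib = 1 := by
  rw [phib_eq]; linear_combination phi_sq

lemma phib_sq : phib ^ 2 = 1 - phib := by
  rw [phib_eq]; linear_combination phi_sq

/-- The slope increment formula in each of the three pieces of `Ω`. -/
lemma rfun_cases {a b : ℝ} (h : (a, b) ∈ Ω) :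
    (phib - a < b ∧ phib - a * phib < b ∧ 0 < b ∧ Rfun (a, b) = 1 / (a * b)) ∨
    (phib - a < b ∧ b ≤ phib - a * phib ∧ 0 < a + b * phi ∧ a + b * phi ≤ 1 ∧
      Rfun (a, b) = phi / (a * (a + b * phi))) ∨
    (b ≤ phib - a ∧ 0 < a + b ∧ phi * (a + b) ≤ 1 ∧ Rfun (a, b) = 1 / (a * (a + b))) := by
  have hh := h
  obtain ⟨h1, h2, h3, h4⟩ := hh
  simp only at h1 h2 h3 h4
  have hb := phib_bounds
  have hm := phi_mul_phib
  have hs := phib_sq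
  have hf : phi = phib + 1 := by rw [phib_eq]; ring
  have h0 := phi_pos
  by_cases c1 : b ≤ phib - a
  · right; right
    have : (a, b) ∈ Ω₁ := ⟨h, by simp only; nlinarith, h2, h3, c1⟩
    refine ⟨c1, by nlinarith, by nlinarith, ?_⟩
    simp [Rfun, this]
  · push Not at c1
    have n1 : (a, b) ∉ Ω₁ := fun hc => by have := hc.2.2.2.2; simp only at this; linarith
    by_cases c2 : b ≤ phib - a * phib
    · right; left
      have : (a, b) ∈ Ωphi := ⟨h, by simp only; nlinarith, h2, c1, c2⟩
      have hpos : 0 < a + b * phi := by nlinarith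
      refine ⟨c1, c2, hpos, by nlinarith, ?_⟩
      simp only [Rfun, n1, this, if_true, if_false]
      have : a * phib + b = (a + b * phi) / phi := by
        field_simp; linear_combination a * hm
      rw [this]; field_simp
    · push Not at c2
      left
      have n2 : (a, b) ∉ Ωphi := fun hc => by have := hc.2.2.2.2; simp only at this; linarith
      refine ⟨c1, c2, by nlinarith, ?_⟩
      simp [Rfun, n1, n2]

lemma exists_successor {a b : ℝ} (h : (a, b) ∈ Ω) : ∃ p q : ℝ, (p, q) ∈ Λ ∧ 0 < q ∧
    0 < a * p + b * q ∧ a * p + b * q ≤ 1 ∧ q / (a * (a * p + b * q)) = Rfun (a, b) := by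
  have h0 := phi_pos
  rcases rfun_cases h with ⟨_, _, h1, h2⟩ | ⟨_, _, h1, h3, h2⟩ | ⟨_, h1, h3, h2⟩
  · refine ⟨0, 1, quadVec_mem .e2, one_pos, by linarith, by linarith [h.2.2.2], ?_⟩
    rw [h2]; simp
  · refine ⟨1, phi, quadVec_mem (QuadVec.e1.m4.congr rfl (by ring)), h0,
      by linarith, by linarith, ?_⟩
    rw [h2]; simp
  · refine ⟨phi, phi, quadVec_mem (QuadVec.e2.m2.congr (by ring) (by ring)), h0,
      by nlinarith, by nlinarith, ?_⟩
    rw [h2]; field_simp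

lemma one_le_rfun {a b : ℝ} (h : (a, b) ∈ Ω) : 1 ≤ Rfun (a, b) := by
  obtain ⟨p, q, hm, hq, h1, h2, h3⟩ := exists_successor h
  rw [← h3]
  have hq1 : 1 ≤ q := by
    rcases orbit_snd hm with h | h
    · exact absurd h hq.ne'
    · rwa [abs_of_pos hq] at h
  rw [le_div_iff₀ (mul_pos h.1 h1)]
  have := h.1
  have := h.2.1
  simp only at *
  nlinarith

lemma rfun_le {a b p q : ℝ} (h : (a, b) ∈ Ω) (hv : (p, q) ∈ Λ) (hq : 0 < q)
    (h0 : 0 < a * p + b * q) (h1 : a * p + b * q ≤ 1) :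
    Rfun (a, b) ≤ q / (a * (a * p + b * q)) := by
  have hphi := phi_gt
  have hphi2 := phi_lt
  have hs := phi_sq
  have hb := phib_bounds
  have hm := phi_mul_phib
  have ha : 0 < a := h.1
  have ha1 : a ≤ 1 := h.2.1
  have hab : 1 < a * phi + b := by have := h.2.2.1; simp only at this; linarith
  have hcase : p ≤ 0 ∨ QuadVec p q := by
    by_cases hp : p ≤ 0
    · exact Or.inl hp
    · exact Or.inr (quadVec_of_nonneg hv (by linarith) hq.le)
  -- linear forms on the sectors exceed one
  have big : ∀ {x y α β : ℝ}, QuadVec x y → 1 < α → 1 < β → 1 < x * α + y * β := by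
    intro x y α β hxy hα hβ
    have h1 := hxy.one_le_add
    have h2 := hxy.fst_nonneg
    have h3 := hxy.snd_nonneg
    rcases h2.eq_or_lt with h4 | h4
    · subst h4; nlinarith
    · linarith [mul_pos h4 (sub_pos.2 hα), mul_nonneg h3 (sub_pos.2 hβ).le]
  have m1false : ∀ {x : ℝ}, QuadVec x q → a * (x + phi * q) + b * q ≤ 1 → False := by
    intro x hx hle
    have h2 := hx.fst_nonneg
    have h3 : 1 ≤ q := by rcases hx.snd_cases with h | h <;> linarith
    linarith [mul_nonneg ha.le h2, le_mul_of_one_le_left (by linarith : 0 ≤ a * phi + b) h3]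
  rcases rfun_cases h with ⟨c1, c2, c3, hR⟩ | ⟨c1, c2, c3, c4, hR⟩ | ⟨c1, c2, c3, hR⟩
  · have hp : p ≤ 0 := by
      by_contra hp
      push Not at hp
      have hQ := quadVec_of_nonneg hv hp.le hq.le
      have f1 : 1 < phi * (a + b) := by nlinarith
      have f2 : 1 < a + b * phi := by nlinarith
      cases hQ with
      | e1 => simp at hq
      | e2 => simp at hp
      | m1 hx => exact m1false hx h1
      | m2 hx => linarith [big hx hab f1]
      | m3 hx => linarith [big hx f1 f2]
      | m4 hx =>
        have h2 := hx.snd_nonneg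
        have h3 : 1 ≤ p := by rcases hx.fst_cases with h | h <;> linarith
        linarith [mul_nonneg c3.le h2, le_mul_of_one_le_left (by linarith : 0 ≤ a + b * phi) h3]
    rw [hR, div_le_div_iff₀ (by positivity) (by positivity)]
    nlinarith [mul_nonneg ha.le (mul_nonneg ha.le (neg_nonneg.2 hp))]
  · have hp : phi * p ≤ q := by
      rcases hcase with hp | hQ
      · linarith [mul_nonneg phi_pos.le (neg_nonneg.2 hp)]
      have f1 : 1 < phi * (a + b) := by nlinarith
      cases hQ with
      | e1 => simp at hq
      | e2 => simp
      | m1 hx => exact (m1false hx h1).elim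
      | m2 hx => linarith [big hx hab f1]
      | @m3 x y hx =>
        rcases hx.fst_cases with h2 | h2
        · subst h2; linarith
        · exfalso
          have h3 := hx.snd_nonneg
          linarith [mul_nonneg c3.le h3, le_mul_of_one_le_left (by linarith : 0 ≤ phi * (a + b)) h2]
      | m4 hx => linarith [hx.snd_nonneg]
    rw [hR, div_le_div_iff₀ (by positivity) (by positivity)]
    nlinarith [mul_nonneg ha.le (mul_nonneg ha.le (sub_nonneg.2 hp))]
  · have hp : p ≤ q := by
      rcases hcase with hp | hQ
      · linarith
      cases hQ with
      | e1 => simp at hq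
      | e2 => simp
      | m1 hx => exact (m1false hx h1).elim
      | m2 hx =>
        rcases hx.fst_cases with h2 | h2
        · subst h2; linarith
        · exfalso
          have h3 := hx.snd_nonneg
          linarith [mul_nonneg (mul_nonneg phi_pos.le c2.le) h3, le_mul_of_one_le_left (by linarith : 0 ≤ a * phi + b) h2]
      | m3 hx => nlinarith [hx.snd_nonneg]
      | m4 hx => nlinarith [hx.snd_nonneg, hx.fst_nonneg]
    rw [hR, div_le_div_iff₀ (by positivity) (by positivity)]
    nlinarith [mul_nonneg ha.le (mul_nonneg ha.le (sub_nonneg.2 hp))]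

lemma exists_normalize (a b : ℝ) (ha : 0 < a) :
    ∃ k : ℤ, 1 - a * phi < b + k * (phi * a) ∧ b + k * (phi * a) ≤ 1 := by
  obtain ⟨k, hk, -⟩ := existsUnique_add_zsmul_mem_Ioc (mul_pos phi_pos ha) b (1 - a * phi)
  refine ⟨k, ?_, ?_⟩
  · simpa using hk.1
  · have := hk.2
    simp at this
    linarith

instance : MeasurableSpace SL2 := borel SL2
instance : BorelSpace SL2 := ⟨rfl⟩

/-- The rows of an element of `SL(2,ℝ)`. -/
def rows (g : SL2) : (ℝ × ℝ) × (ℝ × ℝ) := ((g.1 0 0, g.1 0 1), (g.1 1 0, g.1 1 1))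

lemma continuous_entry (i j : Fin 2) : Continuous fun g : SL2 => g.1 i j :=
  continuous_subtype_val.matrix_elem i j

lemma isClosedEmbedding_rows : IsClosedEmbedding rows := by
  have hc : Continuous rows := by
    unfold rows
    exact ((continuous_entry _ _).prodMk (continuous_entry _ _)).prodMk
      ((continuous_entry _ _).prodMk (continuous_entry _ _))
  let h : (ℝ × ℝ) × (ℝ × ℝ) → Matrix (Fin 2) (Fin 2) ℝ :=
    fun v => !![v.1.1, v.1.2; v.2.1, v.2.2]
  have hh : Continuous h := by
    refine continuous_matrix fun i j => ?_
    fin_cases i <;> fin_cases j <;> simp [h] <;> fun_prop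
  have hcomp : h ∘ rows = Subtype.val := by
    funext g
    ext i j
    fin_cases i <;> fin_cases j <;> simp [h, rows]
  refine ⟨⟨IsInducing.of_comp hc hh (by rw [hcomp]; exact IsInducing.subtypeVal), ?_⟩, ?_⟩
  · intro g g' hg
    simp only [rows, Prod.mk.injEq] at hg
    exact sl2_ext hg.1.1 hg.1.2 hg.2.1 hg.2.2
  · have : Set.range rows = {v | v.1.1 * v.2.2 - v.1.2 * v.2.1 = 1} := by
      ext v
      constructor
      · rintro ⟨g, rfl⟩; exact sl2_det g
      · intro hv
        exact ⟨⟨h v, by simpa [h, Matrix.det_fin_two] using hv⟩, by simp [rows, h]⟩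
    rw [this]
    exact isClosed_eq (by fun_prop) continuous_const

instance : PolishSpace SL2 := isClosedEmbedding_rows.polishSpace
instance : LocallyCompactSpace SL2 := isClosedEmbedding_rows.locallyCompactSpace

lemma measurableEmbedding_rows : MeasurableEmbedding rows :=
  isClosedEmbedding_rows.measurableEmbedding

lemma measurable_entry (i j : Fin 2) : Measurable fun g : SL2 => g.1 i j :=
  (continuous_entry i j).measurable

/-- The determinant in terms of the rows. -/
def detRows (v : (ℝ × ℝ) × (ℝ × ℝ)) : ℝ := v.1.1 * v.2.2 - v.1.2 * v.2.1

lemma continuous_detRows : Continuous detRows := by unfold detRows; fun_prop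

open Classical in
/-- The radial projection of the cone of matrices of positive determinant to `SL(2,ℝ)`. -/
def coneMap (v : (ℝ × ℝ) × (ℝ × ℝ)) : SL2 :=
  if h : 0 < detRows v then
    ⟨!![v.1.1 / √(detRows v), v.1.2 / √(detRows v); v.2.1 / √(detRows v), v.2.2 / √(detRows v)],
      by
        have h2 : √(detRows v) ^ 2 = detRows v := Real.sq_sqrt h.le
        have h3 : √(detRows v) ≠ 0 := (Real.sqrt_pos.2 h).ne'
        rw [Matrix.det_fin_two_of]
        field_simp
        rw [h2]; unfold detRows; ring⟩
  else 1

lemma rows_coneMap {v : (ℝ × ℝ) × (ℝ × ℝ)} (h : 0 < detRows v) :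
    rows (coneMap v) = ((v.1.1 / √(detRows v), v.1.2 / √(detRows v)),
      (v.2.1 / √(detRows v), v.2.2 / √(detRows v))) := by
  simp [coneMap, h, rows]

lemma measurable_coneMap : Measurable coneMap := by
  rw [← measurableEmbedding_rows.measurable_comp_iff]
  have : rows ∘ coneMap = fun v => if 0 < detRows v then
      ((v.1.1 / √(detRows v), v.1.2 / √(detRows v)),
      (v.2.1 / √(detRows v), v.2.2 / √(detRows v))) else rows 1 := by
    funext v
    by_cases h : 0 < detRows v
    · simp [rows_coneMap h, h]
    · simp [coneMap, h]
  rw [this]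
  have hm := continuous_detRows.measurable
  refine Measurable.ite (measurableSet_lt measurable_const hm) ?_ measurable_const
  fun_prop

/-- Matrices with determinant in `(0, 1]`. -/
def coneSet : Set ((ℝ × ℝ) × (ℝ × ℝ)) := {v | 0 < detRows v ∧ detRows v ≤ 1}

lemma measurableSet_coneSet : MeasurableSet coneSet :=
  (measurableSet_lt measurable_const continuous_detRows.measurable).inter
    (measurableSet_le continuous_detRows.measurable measurable_const)

/-- A Haar measure on `SL(2,ℝ)`. -/
def haarSL : Measure SL2 := (volume.restrict coneSet).map coneMap

instance : SFinite haarSL := by unfold haarSL; infer_instance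

lemma map_haarSL {f : SL2 → SL2} (hf : Measurable f)
    {F : (ℝ × ℝ) × (ℝ × ℝ) → (ℝ × ℝ) × (ℝ × ℝ)} (hF : MeasurePreserving F)
    (hdet : ∀ v, detRows (F v) = detRows v)
    (hcomm : ∀ v, 0 < detRows v → coneMap (F v) = f (coneMap v)) :
    haarSL.map f = haarSL := by
  have hpre : F ⁻¹' coneSet = coneSet := by
    ext v; simp [coneSet, hdet]
  have h1 := hF.restrict_preimage measurableSet_coneSet
  rw [hpre] at h1
  unfold haarSL
  rw [Measure.map_map hf measurable_coneMap]
  nth_rewrite 2 [← h1.map_eq]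
  rw [Measure.map_map measurable_coneMap h1.measurable]
  refine Measure.map_congr ?_
  filter_upwards [ae_restrict_mem measurableSet_coneSet] with v hv
  exact (hcomm v hv.1).symm

lemma measurePreserving_linear {a b c d : ℝ} (h : a * d - b * c = 1) :
    MeasurePreserving (fun x : ℝ × ℝ => (a * x.1 + b * x.2, c * x.1 + d * x.2)) := by
  let f : ℝ × ℝ →ₗ[ℝ] ℝ × ℝ := Matrix.toLin (Module.Basis.finTwoProd ℝ) (Module.Basis.finTwoProd ℝ) !![a, b; c, d]
  have hf : LinearMap.det f = 1 := by
    simp [f, LinearMap.det_toLin, Matrix.det_fin_two_of, h]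
  have h1 := Measure.map_linearMap_addHaar_eq_smul_addHaar (volume : Measure (ℝ × ℝ)) (f := f)
    (by rw [hf]; norm_num)
  rw [hf] at h1
  have h2 : (fun x : ℝ × ℝ => (a * x.1 + b * x.2, c * x.1 + d * x.2)) = f := by
    funext x
    simp [f, Matrix.toLin_finTwoProd_apply]
  rw [h2]
  exact ⟨(by rw [← h2]; fun_prop), by simpa using h1⟩

lemma measurePreserving_transposeRows : MeasurePreserving
    (fun v : (ℝ × ℝ) × (ℝ × ℝ) => ((v.1.1, v.2.1), (v.1.2, v.2.2))) := by
  have h1 := measurePreserving_prodAssoc (volume : Measure ℝ) (volume : Measure ℝ) (volume : Measure (ℝ × ℝ))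
  have h2 := (measurePreserving_prodAssoc (volume : Measure ℝ) (volume : Measure ℝ) (volume : Measure ℝ)).symm
  have h3 : MeasurePreserving (Prod.swap : ℝ × ℝ → ℝ × ℝ) volume volume := Measure.measurePreserving_swap
  have h4 := (h3.prod (MeasurePreserving.id (volume : Measure ℝ)))
  have h5 := (MeasurePreserving.id (volume : Measure ℝ)).prod ((h2.symm.comp (h4.comp h2)))
  exact h1.symm.comp (h5.comp h1)

instance : haarSL.IsMulRightInvariant := by
  constructor
  intro g
  have hd : g.1 0 0 * g.1 1 1 - g.1 1 0 * g.1 0 1 = 1 := by linarith [sl2_det g]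
  have hl := measurePreserving_linear hd
  have hmul : ∀ v, detRows (Prod.map (fun x : ℝ × ℝ => (g.1 0 0 * x.1 + g.1 1 0 * x.2, g.1 0 1 * x.1 + g.1 1 1 * x.2)) (fun x : ℝ × ℝ => (g.1 0 0 * x.1 + g.1 1 0 * x.2, g.1 0 1 * x.1 + g.1 1 1 * x.2)) v) = detRows v := by
    intro v
    simp only [detRows, Prod.map]
    linear_combination (v.1.1 * v.2.2 - v.1.2 * v.2.1) * hd
  refine map_haarSL (measurable_mul_const g) (hl.prod hl) hmul ?_
  intro v hv
  apply measurableEmbedding_rows.injective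
  have hv' := hv
  rw [← hmul] at hv'
  have h1 := rows_coneMap hv
  rw [rows_coneMap hv', hmul]
  simp only [rows, Prod.mk.injEq] at h1
  simp only [rows, sl2_mul, h1, Prod.map, Prod.mk.injEq]
  refine ⟨⟨?_, ?_⟩, ?_, ?_⟩ <;> ring

instance : haarSL.IsMulLeftInvariant := by
  constructor
  intro g
  have hd := sl2_det g
  have hl := measurePreserving_linear hd
  have hF := measurePreserving_transposeRows.comp ((hl.prod hl).comp measurePreserving_transposeRows)
  refine map_haarSL (measurable_const_mul g) hF ?_ ?_
  · intro v
    simp only [detRows, Prod.map, Function.comp]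
    linear_combination (v.1.1 * v.2.2 - v.1.2 * v.2.1) * hd
  intro v hv
  apply measurableEmbedding_rows.injective
  have hmul : detRows ((g.1 0 0 * v.1.1 + g.1 0 1 * v.2.1, g.1 0 0 * v.1.2 + g.1 0 1 * v.2.2),
     (g.1 1 0 * v.1.1 + g.1 1 1 * v.2.1, g.1 1 0 * v.1.2 + g.1 1 1 * v.2.2)) = detRows v := by
    simp only [detRows]
    linear_combination (v.1.1 * v.2.2 - v.1.2 * v.2.1) * hd
  have hv' := hv
  rw [← hmul] at hv'
  have h1 := rows_coneMap hv
  simp only [Prod.map, Function.comp]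
  rw [rows_coneMap hv', hmul]
  simp only [rows, Prod.mk.injEq] at h1
  simp only [rows, sl2_mul, h1, Prod.mk.injEq]
  refine ⟨⟨?_, ?_⟩, ?_, ?_⟩ <;> ring

/-- The coordinates (first row, slope of the first column) on `SL(2,ℝ)`. -/
def coords (g : SL2) : (ℝ × ℝ) × ℝ := ((g.1 0 0, g.1 0 1), g.1 1 0 / g.1 0 0)

lemma measurable_coords : Measurable coords :=
  ((measurable_entry _ _).prodMk (measurable_entry _ _)).prodMk
    ((measurable_entry _ _).div (measurable_entry _ _))

/-- The normalizing constant of the Haar measure in the coordinates `coords`. -/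
def haarConst : ENNReal := ∫⁻ x in Set.Ioc (0 : ℝ) 1, ENNReal.ofReal x

lemma haarConst_ne_top : haarConst ≠ ⊤ := by
  have : haarConst ≤ ∫⁻ x in Set.Ioc (0 : ℝ) 1, 1 := by
    refine setLIntegral_mono measurable_const fun x hx => ?_
    exact ENNReal.ofReal_le_one.2 hx.2
  refine ne_top_of_le_ne_top ?_ this
  simp

lemma haarConst_ne_zero : haarConst ≠ 0 := by
  unfold haarConst
  rw [ne_eq, setLIntegral_eq_zero_iff measurableSet_Ioc (by fun_prop)]
  intro h
  have h2 : volume (Set.Ioc (0 : ℝ) 1) = 0 := by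
    rw [← nonpos_iff_eq_zero, ← MeasureTheory.measure_eq_zero_iff_ae_notMem.2 (h.mono fun x hx hx' => ?_)]
    have := hx hx'
    simp at this
    linarith [hx'.1]
  simp at h2

lemma lintegral_div_div {F : ℝ × ℝ → ENNReal} (hF : Measurable F) {r : ℝ} (hr : 0 < r) :
    ∫⁻ x : ℝ × ℝ, F (x.1 / √r, x.2 / √r) = ENNReal.ofReal r * ∫⁻ x, F x := by
  have hs : 0 < √r := Real.sqrt_pos.2 hr
  have h := Measure.map_addHaar_smul (volume : Measure (ℝ × ℝ)) (inv_ne_zero hs.ne')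
  have h2 : Measurable fun x : ℝ × ℝ => (√r)⁻¹ • x := measurable_const_smul _
  have h3 : (fun x : ℝ × ℝ => F (x.1 / √r, x.2 / √r)) = fun x => F ((√r)⁻¹ • x) := by
    funext x
    congr 1
    ext <;> simp [div_eq_inv_mul]
  rw [h3, ← lintegral_map hF h2, h, lintegral_smul_measure]
  congr 1
  have : Module.finrank ℝ (ℝ × ℝ) = 2 := by simp
  rw [this, inv_pow, inv_inv, Real.sq_sqrt hr.le, abs_of_pos hr]

lemma lintegral_coords {f : (ℝ × ℝ) × ℝ → ENNReal} (hf : Measurable f)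
    (hf0 : ∀ x, x.1.1 ≤ 0 → f x = 0) :
    ∫⁻ g, f (coords g) ∂haarSL = haarConst * ∫⁻ x, f x := by
  unfold haarSL
  rw [lintegral_map (f := fun g => f (coords g)) (hf.comp measurable_coords) measurable_coneMap]
  let H : (ℝ × ℝ) × (ℝ × ℝ) → ENNReal := fun y =>
    (Set.Ioc (0 : ℝ) 1).indicator (fun D => f ((y.1.1 / √D, y.1.2 / √D), y.2.1)) y.2.2
  have hH : Measurable H := by
    have : H = ({y | y.2.2 ∈ Set.Ioc (0 : ℝ) 1}).indicator
      (fun y => f ((y.1.1 / √y.2.2, y.1.2 / √y.2.2), y.2.1)) := by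
      funext y; simp only [H, Set.indicator, Set.mem_ofPred_eq]
    rw [this]
    refine Measurable.indicator ?_ ?_
    · exact hf.comp (by fun_prop)
    · exact measurableSet_Ioc.preimage (by fun_prop)
  have e1 : ∫⁻ v in coneSet, f (coords (coneMap v)) =
      ∫⁻ v : (ℝ × ℝ) × (ℝ × ℝ), H (v.1, (v.2.1 / v.1.1, detRows v)) := by
    rw [← lintegral_indicator measurableSet_coneSet]
    refine lintegral_congr fun v => ?_
    by_cases hv : v ∈ coneSet
    · have h1 := rows_coneMap hv.1
      simp only [rows, Prod.mk.injEq] at h1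
      have h3 : √(detRows v) ≠ 0 := (Real.sqrt_pos.2 hv.1).ne'
      have h4 : detRows v ∈ Set.Ioc (0 : ℝ) 1 := hv
      simp only [Set.indicator_of_mem hv, H, coords, h1, Set.indicator_of_mem h4]
      rw [div_div_div_cancel_right₀ h3]
    · have h4 : detRows v ∉ Set.Ioc (0 : ℝ) 1 := hv
      simp only [Set.indicator_of_notMem hv, H, Set.indicator_of_notMem h4]
  have e2 : ∀ u : ℝ × ℝ, ∫⁻ w : ℝ × ℝ, H (u, (w.1 / u.1, detRows (u, w))) = ∫⁻ w, H (u, w) := by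
    intro u
    by_cases hu : 0 < u.1
    · have hl : MeasurePreserving fun w : ℝ × ℝ => (u.1⁻¹ * w.1 + 0 * w.2, -u.2 * w.1 + u.1 * w.2) :=
        measurePreserving_linear (by field_simp; ring)
      rw [← hl.lintegral_comp (f := fun w => H (u, w)) (hH.comp measurable_prodMk_left)]
      refine lintegral_congr fun w => ?_
      congr 3
      · ring
      · simp only [detRows]; ring
    · have h0 : ∀ w, H (u, w) = 0 := by
        intro w
        refine Set.indicator_apply_eq_zero.2 fun _ => hf0 _ ?_
        exact div_nonpos_of_nonpos_of_nonneg (not_lt.1 hu) (Real.sqrt_nonneg _)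
      simp [h0]
  obtain ⟨G, hG⟩ : ∃ G : ℝ → ENNReal, ∀ s, G s = ∫⁻ u : ℝ × ℝ, f (u, s) := ⟨_, fun _ => rfl⟩
  have e3 : ∀ w : ℝ × ℝ, ∫⁻ u, H (u, w) =
      G w.1 * (Set.Ioc (0 : ℝ) 1).indicator ENNReal.ofReal w.2 := by
    intro w
    by_cases hw : w.2 ∈ Set.Ioc (0 : ℝ) 1
    · simp only [H, Set.indicator_of_mem hw, hG]
      rw [lintegral_div_div (F := fun x => f (x, w.1)) (hf.comp measurable_prodMk_right) hw.1]
      rw [mul_comm]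
    · simp [H, Set.indicator_of_notMem hw]
  have hGm : Measurable G := by
    rw [funext hG]; exact Measurable.lintegral_prod_left' hf
  have e4 : ∫⁻ x, f x = ∫⁻ s, G s := by
    rw [Measure.volume_eq_prod, lintegral_prod_symm' _ hf]
    simp_rw [hG]
  rw [e1, e4, Measure.volume_eq_prod, lintegral_prod]
  · simp_rw [e2]
    rw [← lintegral_prod _ hH.aemeasurable, lintegral_prod_symm' _ hH]
    simp_rw [e3]
    rw [Measure.volume_eq_prod ℝ ℝ, lintegral_prod_mul hGm.aemeasurable
      ((ENNReal.measurable_ofReal.indicator measurableSet_Ioc).aemeasurable)]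
    rw [lintegral_indicator measurableSet_Ioc, mul_comm]
    rfl
  · refine (hH.comp ?_).aemeasurable
    have := continuous_detRows.measurable
    fun_prop

lemma haarSL_preimage_coords {E : Set ((ℝ × ℝ) × ℝ)} (hE : MeasurableSet E)
    (h0 : ∀ x ∈ E, 0 < x.1.1) : haarSL (coords ⁻¹' E) = haarConst * volume E := by
  have h := lintegral_coords (f := E.indicator 1) (measurable_one.indicator hE) fun x hx => by
    refine Set.indicator_of_notMem (fun hc => ?_) _
    linarith [h0 x hc]
  rw [lintegral_indicator_one hE] at h
  rw [← h, ← lintegral_indicator_one (measurable_coords hE)]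
  rfl

/-- The fundamental domain for the right action of `Γ` on `SL(2,ℝ)`: suspension of `Ω` with roof
function `Rfun`. -/
def suspension : Set ((ℝ × ℝ) × ℝ) := {x | x.1 ∈ Ω ∧ -Rfun x.1 < x.2 ∧ x.2 ≤ 0}

def fundDom : Set SL2 := coords ⁻¹' suspension

lemma measurableSet_Omega : MeasurableSet Ω := by
  have e : Ω = {p : ℝ × ℝ | 0 < p.1} ∩ {p | p.1 ≤ 1} ∩ {p | 1 - p.1 * phi < p.2} ∩
      {p | p.2 ≤ 1} := by
    ext p; simp [Ω, and_assoc]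
  rw [e]
  exact (((measurableSet_lt (by fun_prop) (by fun_prop)).inter
    (measurableSet_le (by fun_prop) (by fun_prop))).inter
    (measurableSet_lt (by fun_prop) (by fun_prop))).inter
    (measurableSet_le (by fun_prop) (by fun_prop))

lemma measurableSet_Omega_one : MeasurableSet Ω₁ := by
  have e : Ω₁ = Ω ∩ {p | phib ≤ p.1} ∩ {p | p.2 ≤ phib - p.1} := by
    ext p; simp only [Ω₁, Ω, Set.mem_inter_iff, Set.mem_ofPred_eq]; tauto
  rw [e]
  exact (measurableSet_Omega.inter (measurableSet_le (by fun_prop) (by fun_prop))).inter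
    (measurableSet_le (by fun_prop) (by fun_prop))

lemma measurableSet_Omega_phi : MeasurableSet Ωphi := by
  have e : Ωphi = Ω ∩ {p | phib ^ 2 ≤ p.1} ∩ {p | phib - p.1 < p.2} ∩
      {p | p.2 ≤ phib - p.1 * phib} := by
    ext p; simp only [Ωphi, Ω, Set.mem_inter_iff, Set.mem_ofPred_eq]; tauto
  rw [e]
  exact ((measurableSet_Omega.inter (measurableSet_le (by fun_prop) (by fun_prop))).inter
    (measurableSet_lt (by fun_prop) (by fun_prop))).inter
    (measurableSet_le (by fun_prop) (by fun_prop))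

lemma measurable_Rfun : Measurable Rfun := by
  unfold Rfun
  refine Measurable.ite measurableSet_Omega_one (by fun_prop) ?_
  exact Measurable.ite measurableSet_Omega_phi (by fun_prop) (by fun_prop)

lemma measurableSet_suspension : MeasurableSet suspension := by
  have := measurable_Rfun
  have e : suspension = (fun x : (ℝ × ℝ) × ℝ => x.1) ⁻¹' Ω ∩
      {x | -Rfun x.1 < x.2} ∩ {x | x.2 ≤ 0} := by
    ext p; simp [suspension, and_assoc]
  rw [e]
  exact ((measurableSet_Omega.preimage measurable_fst).inter
    (measurableSet_lt (by fun_prop) (by fun_prop))).inter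
    (measurableSet_le (by fun_prop) (by fun_prop))

lemma measurableSet_fundDom : MeasurableSet fundDom :=
  measurableSet_suspension.preimage measurable_coords

/-- The change of slope under the right action. -/
lemma slope_mul (g γ : SL2) (h0 : g.1 0 0 ≠ 0)
    (h1 : (g * γ).1 0 0 ≠ 0) : (g * γ).1 1 0 / (g * γ).1 0 0 =
      g.1 1 0 / g.1 0 0 + γ.1 1 0 / (g.1 0 0 * (g * γ).1 0 0) := by
  have hd := sl2_det g
  field_simp
  simp only [sl2_mul]
  linear_combination γ.1 1 0 * hd

lemma rfun_le_slope_sub {g γ : SL2} (hγ : γ ∈ Γ) (hg : (g.1 0 0, g.1 0 1) ∈ Ω)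
    (hgγ : ((g * γ).1 0 0, (g * γ).1 0 1) ∈ Ω) (hq : 0 < γ.1 1 0) :
    g.1 1 0 / g.1 0 0 + Rfun (g.1 0 0, g.1 0 1) ≤ (g * γ).1 1 0 / (g * γ).1 0 0 := by
  rw [slope_mul g γ hg.1.ne' hgγ.1.ne']
  have e : (g * γ).1 0 0 = g.1 0 0 * γ.1 0 0 + g.1 0 1 * γ.1 1 0 := sl2_mul _ _ _ _
  have h1 := hgγ.1
  have h2 := hgγ.2.1
  simp only at h1 h2
  rw [e] at h1 h2 ⊢
  gcongr
  exact rfun_le hg (col_one_mem hγ) hq h1 h2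

/-- Two elements with first row in `Ω`, in the same right coset of `Γ` and with proportional first
columns are equal. -/
lemma eq_one_of_snd_zero {g γ : SL2} (hγ : γ ∈ Γ) (hg : (g.1 0 0, g.1 0 1) ∈ Ω)
    (hgγ : ((g * γ).1 0 0, (g * γ).1 0 1) ∈ Ω) (hq : γ.1 1 0 = 0) : γ = 1 := by
  have hc := col_one_mem hγ
  have e0 : (g * γ).1 0 0 = g.1 0 0 * γ.1 0 0 + g.1 0 1 * γ.1 1 0 := sl2_mul _ _ _ _
  have e1 : (g * γ).1 0 1 = g.1 0 0 * γ.1 0 1 + g.1 0 1 * γ.1 1 1 := sl2_mul _ _ _ _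
  rw [hq] at hc e0
  have h1 := hg.1
  have h2 := hgγ.1
  simp only at h1 h2
  rcases orbit_snd_zero hc with h | h
  · obtain ⟨k, rfl⟩ := eq_pmat_zpow hγ h hq
    simp only [(pmat_zpow k).1, (pmat_zpow k).2.1, (pmat_zpow k).2.2.2] at e0 e1
    have l1 := hg.2.2.1
    have l2 := hg.2.2.2
    have l3 := hgγ.2.2.1
    have l4 := hgγ.2.2.2
    simp only at l1 l2 l3 l4
    rw [e0, e1] at l3
    rw [e1] at l4
    have hpos := mul_pos h1 phi_pos
    have k1 : (k : ℝ) < 1 := by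
      by_contra hk
      push Not at hk
      linarith [le_mul_of_one_le_left hpos.le hk]
    have k2 : (-1 : ℝ) < k := by
      by_contra hk
      push Not at hk
      linarith [le_mul_of_one_le_left hpos.le (by linarith : 1 ≤ -(k : ℝ))]
    have : k = 0 := by
      have := (by exact_mod_cast k1 : k < 1)
      have := (by exact_mod_cast k2 : -1 < k)
      omega
    simp [this]
  · rw [h] at e0; linarith

lemma fundDom_unique {g γ : SL2} (hγ : γ ∈ Γ) (hg : g ∈ fundDom) (hgγ : g * γ ∈ fundDom) :
    γ = 1 := by
  obtain ⟨h1, h2, h3⟩ := hg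
  obtain ⟨k1, k2, k3⟩ := hgγ
  simp only [coords] at h1 h2 h3 k1 k2 k3
  rcases lt_trichotomy (γ.1 1 0) 0 with hq | hq | hq
  · have e : g * γ * γ⁻¹ = g := by group
    have := rfun_le_slope_sub (g := g * γ) (γ := γ⁻¹) (inv_mem hγ) k1 (by rw [e]; exact h1)
      (by rw [(sl2_inv γ).2.2.1]; linarith)
    rw [e] at this
    linarith
  · exact eq_one_of_snd_zero hγ h1 k1 hq
  · have := rfun_le_slope_sub hγ h1 k1 hq
    linarith

lemma exists_mul_row {g : SL2} {p q : ℝ} (hv : (p, q) ∈ Λ)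
    (h0 : 0 < g.1 0 0 * p + g.1 0 1 * q) (h1 : g.1 0 0 * p + g.1 0 1 * q ≤ 1) :
    ∃ γ ∈ Γ, γ.1 0 0 = p ∧ γ.1 1 0 = q ∧ (g * γ).1 0 0 = g.1 0 0 * p + g.1 0 1 * q ∧
      ((g * γ).1 0 0, (g * γ).1 0 1) ∈ Ω := by
  obtain ⟨δ, hδ, rfl, rfl⟩ := exists_col hv
  have e : (g * δ).1 0 0 = g.1 0 0 * δ.1 0 0 + g.1 0 1 * δ.1 1 0 := sl2_mul _ _ _ _
  rw [← e] at h0 h1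
  obtain ⟨k, hk1, hk2⟩ := exists_normalize _ ((g * δ).1 0 1) h0
  refine ⟨δ * Pmat ^ k, mul_mem hδ (pmat_zpow_mem k), ?_, ?_, ?_, ?_⟩
  · simp [sl2_mul, pmat_zpow]
  · simp [sl2_mul, pmat_zpow]
  · simp [sl2_mul, pmat_zpow]
  · have f0 : (g * (δ * Pmat ^ k)).1 0 0 = (g * δ).1 0 0 := by
      rw [← mul_assoc, sl2_mul (g * δ)]; simp [pmat_zpow]
    have f1 : (g * (δ * Pmat ^ k)).1 0 1 = (g * δ).1 0 1 + k * (phi * (g * δ).1 0 0) := by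
      rw [← mul_assoc, sl2_mul (g * δ)]; simp only [pmat_zpow]; ring
    rw [f0, f1]
    exact ⟨h0, h1, hk1, hk2⟩

lemma exists_slope_succ {g : SL2} (hg : (g.1 0 0, g.1 0 1) ∈ Ω) :
    ∃ γ ∈ Γ, ((g * γ).1 0 0, (g * γ).1 0 1) ∈ Ω ∧
      (g * γ).1 1 0 / (g * γ).1 0 0 = g.1 1 0 / g.1 0 0 + Rfun (g.1 0 0, g.1 0 1) := by
  obtain ⟨p, q, hv, hq, h0, h1, hR⟩ := exists_successor hg
  obtain ⟨γ, hγ, rfl, rfl, e, hΩ⟩ := exists_mul_row hv h0 h1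
  refine ⟨γ, hγ, hΩ, ?_⟩
  rw [slope_mul g γ hg.1.ne' hΩ.1.ne', e, hR]

lemma exists_slope_pred {g : SL2} (hg : (g.1 0 0, g.1 0 1) ∈ Ω) :
    ∃ γ ∈ Γ, ((g * γ).1 0 0, (g * γ).1 0 1) ∈ Ω ∧
      (g * γ).1 1 0 / (g * γ).1 0 0 ≤ g.1 1 0 / g.1 0 0 - 1 := by
  have ha : 0 < g.1 0 0 := hg.1
  obtain ⟨k, hk1, hk2⟩ := exists_normalize (g.1 0 0) (-g.1 0 1) ha
  have hΩ' : (g.1 0 0, -g.1 0 1 + k * (phi * g.1 0 0)) ∈ Ω := ⟨ha, hg.2.1, hk1, hk2⟩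
  obtain ⟨p, q, hv, hq, h0, h1, hR⟩ := exists_successor hΩ'
  have hR1 := one_le_rfun hΩ'
  have hv' := reflect_mem (shear_zpow_mem hv k)
  have e : g.1 0 0 * p + (-g.1 0 1 + k * (phi * g.1 0 0)) * q =
    g.1 0 0 * (p + k * phi * q) + g.1 0 1 * -q := by ring
  rw [e] at h0 h1 hR
  obtain ⟨γ, hγ, -, e2, e', hΩ⟩ := exists_mul_row hv' h0 h1
  refine ⟨γ, hγ, hΩ, ?_⟩
  rw [slope_mul g γ hg.1.ne' hΩ.1.ne', e', e2, neg_div]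
  linarith

lemma exists_mem_fundDom_of_nonpos (n : ℕ) : ∀ g : SL2, (g.1 0 0, g.1 0 1) ∈ Ω →
    g.1 1 0 / g.1 0 0 ≤ 0 → -(n : ℝ) < g.1 1 0 / g.1 0 0 → ∃ γ ∈ Γ, g * γ ∈ fundDom := by
  induction n with
  | zero => intro g _ h1 h2; simp at h2; linarith
  | succ n ih =>
    intro g hg h1 h2
    by_cases h : -Rfun (g.1 0 0, g.1 0 1) < g.1 1 0 / g.1 0 0
    · exact ⟨1, one_mem _, by rw [mul_one]; exact ⟨hg, h, h1⟩⟩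
    · push Not at h
      obtain ⟨γ, hγ, hΩ, hs⟩ := exists_slope_succ hg
      have := one_le_rfun hg
      push_cast at h2
      obtain ⟨δ, hδ, hF⟩ := ih (g * γ) hΩ (by linarith) (by linarith)
      exact ⟨γ * δ, mul_mem hγ hδ, by rwa [← mul_assoc]⟩

lemma exists_slope_le (n : ℕ) {g : SL2} (hg : (g.1 0 0, g.1 0 1) ∈ Ω) :
    ∃ γ ∈ Γ, ((g * γ).1 0 0, (g * γ).1 0 1) ∈ Ω ∧
      (g * γ).1 1 0 / (g * γ).1 0 0 ≤ g.1 1 0 / g.1 0 0 - n := by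
  induction n with
  | zero => exact ⟨1, one_mem _, by simpa using hg, by simp⟩
  | succ n ih =>
    obtain ⟨γ, hγ, hΩ, hs⟩ := ih
    obtain ⟨δ, hδ, hΩ', hs'⟩ := exists_slope_pred hΩ
    rw [mul_assoc] at hΩ' hs'
    refine ⟨γ * δ, mul_mem hγ hδ, hΩ', ?_⟩
    push_cast
    linarith

lemma exists_mem_fundDom_of_mem_Omega {g : SL2} (hg : (g.1 0 0, g.1 0 1) ∈ Ω) :
    ∃ γ ∈ Γ, g * γ ∈ fundDom := by
  obtain ⟨n, hn⟩ := exists_nat_ge (g.1 1 0 / g.1 0 0)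
  obtain ⟨γ, hγ, hΩ, hs⟩ := exists_slope_le n hg
  obtain ⟨k, hk⟩ := exists_nat_gt (-((g * γ).1 1 0 / (g * γ).1 0 0))
  obtain ⟨δ, hδ, hF⟩ := exists_mem_fundDom_of_nonpos k (g * γ) hΩ (by linarith) (by linarith)
  exact ⟨γ * δ, mul_mem hγ hδ, by rwa [← mul_assoc]⟩

lemma exists_small_entry {g : SL2} (hg : ∀ γ ∈ Γ, (g * γ).1 0 0 ≠ 0) (n : ℕ) :
    ∃ γ ∈ Γ, |(g * γ).1 0 0| ≤ 0.85 ^ n * |g.1 0 0| := by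
  induction n with
  | zero => exact ⟨1, one_mem _, by simp⟩
  | succ n ih =>
    obtain ⟨γ, hγ, h⟩ := ih
    have ha := abs_pos.2 (hg γ hγ)
    set a := (g * γ).1 0 0 with ha'
    set b := (g * γ).1 0 1 with hb'
    have hpa : 0 < phi * |a| := mul_pos phi_pos ha
    obtain ⟨k, hk, -⟩ := existsUnique_add_zsmul_mem_Ioc hpa b (-(phi * |a| / 2))
    have hk1 := hk.1
    have hk2 := hk.2
    simp only [zsmul_eq_mul] at hk1 hk2
    obtain ⟨l, hl⟩ : ∃ l : ℤ, (k : ℝ) * (phi * |a|) = l * phi * a := by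
      rcases abs_choice a with h | h
      · exact ⟨k, by rw [h]; ring⟩
      · exact ⟨-k, by rw [h]; push_cast; ring⟩
    refine ⟨γ * (Pmat ^ l * Smat), mul_mem hγ (mul_mem (pmat_zpow_mem l) smat_mem), ?_⟩
    have e : (g * (γ * (Pmat ^ l * Smat))).1 0 0 = b + l * phi * a := by
      rw [← mul_assoc, sl2_mul (g * γ)]
      simp only [sl2_mul (Pmat ^ l), pmat_zpow]
      simp [Smat, ← ha', ← hb']
      ring
    rw [e, ← hl]
    have h3 : |b + k * (phi * |a|)| ≤ phi * |a| / 2 := abs_le.2 ⟨hk1.le, by linarith⟩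
    calc _ ≤ phi * |a| / 2 := h3
      _ ≤ 0.85 * |a| := by nlinarith [phi_lt]
      _ ≤ 0.85 * (0.85 ^ n * |g.1 0 0|) := by gcongr
      _ = _ := by ring

lemma exists_mem_fundDom {g : SL2} (hg : ∀ γ ∈ Γ, (g * γ).1 0 0 ≠ 0) :
    ∃ γ ∈ Γ, g * γ ∈ fundDom := by
  have hlim : Tendsto (fun n : ℕ => (0.85 : ℝ) ^ n * |g.1 0 0|) atTop (𝓝 (0 * |g.1 0 0|)) :=
    (tendsto_pow_atTop_nhds_zero_of_lt_one (by norm_num) (by norm_num)).mul_const _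
  rw [zero_mul] at hlim
  obtain ⟨n, hn⟩ := (hlim.eventually_le_const one_pos).exists
  obtain ⟨γ, hγ, h⟩ := exists_small_entry hg n
  have h1 : |(g * γ).1 0 0| ≤ 1 := h.trans hn
  have h0 := hg γ hγ
  have : ∃ p q : ℝ, (p, q) ∈ Λ ∧ (g * γ).1 0 0 * p + (g * γ).1 0 1 * q = |(g * γ).1 0 0| := by
    rcases abs_choice ((g * γ).1 0 0) with h | h
    · exact ⟨1, 0, e1_mem, by rw [h]; ring⟩
    · exact ⟨-1, -0, neg_mem_orbit e1_mem, by rw [h]; ring⟩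
  obtain ⟨p, q, hv, hpq⟩ := this
  obtain ⟨δ, hδ, -, -, -, hΩ⟩ := exists_mul_row hv (by rw [hpq]; exact abs_pos.2 h0)
    (by rw [hpq]; exact h1)
  obtain ⟨ε, hε, hF⟩ := exists_mem_fundDom_of_mem_Omega hΩ
  refine ⟨γ * δ * ε, mul_mem (mul_mem hγ hδ) hε, ?_⟩
  rwa [← mul_assoc, ← mul_assoc]

lemma gamma_eq_one {γ : SL2} (hγ : γ ∈ Γ) (h0 : 0 < γ.1 0 0) (h1 : |γ.1 0 1| < 1)
    (h2 : |γ.1 1 0| < 1) : γ = 1 := by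
  have hd := sl2_det γ
  have e1 : γ.1 0 1 = 0 := (orbit_fst (col_two_mem hγ)).resolve_right (not_le.2 h1)
  have e2 : γ.1 1 0 = 0 := (orbit_snd (col_one_mem hγ)).resolve_right (not_le.2 h2)
  have hc := col_one_mem hγ
  rw [e2] at hc
  have e0 : γ.1 0 0 = 1 := (orbit_snd_zero hc).resolve_right (by linarith)
  rw [e0, e1, e2] at hd
  exact sl2_ext (by simpa using e0) (by simpa using e1) (by simpa using e2)
    (by simp; linarith)

instance : DiscreteTopology Γ := by
  apply discreteTopology_of_isOpen_singleton_one
  have ho : IsOpen {g : SL2 | 0 < g.1 0 0 ∧ |g.1 0 1| < 1 ∧ |g.1 1 0| < 1} := by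
    refine (isOpen_lt continuous_const (continuous_entry 0 0)).and
      ((isOpen_lt (continuous_entry 0 1).abs continuous_const).and
        (isOpen_lt (continuous_entry 1 0).abs continuous_const))
  convert ho.preimage (continuous_subtype_val (p := fun g => g ∈ Γ))
  ext γ
  constructor
  · rintro rfl
    simp
  · rintro ⟨h0, h1, h2⟩
    exact Subtype.ext (gamma_eq_one γ.2 h0 h1 h2)

instance : Countable Γ := countable_of_Lindelof_of_discrete

instance : IsClosed (Γ : Set SL2) := Subgroup.isClosed_of_discrete

lemma haarSL_entry_zero : haarSL {g : SL2 | g.1 0 0 = 0} = 0 := by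
  have hm : MeasurableSet {g : SL2 | g.1 0 0 = 0} :=
    measurable_entry 0 0 (measurableSet_singleton 0)
  unfold haarSL
  rw [Measure.map_apply measurable_coneMap hm,
    Measure.restrict_apply' measurableSet_coneSet]
  have h : (volume : Measure ((ℝ × ℝ) × (ℝ × ℝ))) ((({0} : Set ℝ) ×ˢ Set.univ) ×ˢ Set.univ) = 0 := by
    rw [Measure.volume_eq_prod, Measure.prod_prod, Measure.volume_eq_prod, Measure.prod_prod]
    simp
  refine measure_mono_null ?_ h
  rintro v ⟨hv, hv1⟩
  have h1 := rows_coneMap hv1.1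
  simp only [rows, Prod.mk.injEq] at h1
  have h2 : (coneMap v).1 0 0 = 0 := hv
  rw [h1.1.1, div_eq_zero_iff] at h2
  simp only [Set.mem_prod, Set.mem_singleton_iff, Set.mem_univ, and_true]
  exact h2.resolve_right (Real.sqrt_pos.2 hv1.1).ne'

lemma isFundamentalDomain_fundDom : IsFundamentalDomain Γ.op fundDom haarSL where
  nullMeasurableSet := measurableSet_fundDom.nullMeasurableSet
  ae_covers := by
    have h : ∀ᵐ g : SL2 ∂haarSL, ∀ γ : Γ, (g * (γ : SL2)).1 0 0 ≠ 0 := by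
      rw [ae_all_iff]
      intro γ
      have h1 := measure_preimage_mul_right haarSL (γ : SL2) {g : SL2 | g.1 0 0 = 0}
      rw [haarSL_entry_zero] at h1
      exact measure_eq_zero_iff_ae_notMem.1 h1
    filter_upwards [h] with g hg
    obtain ⟨γ, hγ, h⟩ := exists_mem_fundDom fun γ hγ => hg ⟨γ, hγ⟩
    exact ⟨⟨MulOpposite.op γ, hγ⟩, h⟩
  aedisjoint := by
    rintro ⟨a, ha⟩ ⟨b, hb⟩ hab
    refine Disjoint.aedisjoint ?_
    rw [Set.disjoint_left]
    rintro _ ⟨x, hx, rfl⟩ ⟨y, hy, hxy⟩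
    obtain ⟨a, rfl⟩ := MulOpposite.op_surjective a
    obtain ⟨b, rfl⟩ := MulOpposite.op_surjective b
    have hxy : y * b = x * a := hxy
    have ha : a ∈ Γ := ha
    have hb : b ∈ Γ := hb
    have e : x * (a * b⁻¹) = y := by rw [← mul_assoc, ← hxy]; group
    have := fundDom_unique (mul_mem ha (inv_mem hb)) hx (by rwa [e])
    apply hab
    rw [mul_inv_eq_one] at this
    simp [this]

lemma rfun_bounds {a b : ℝ} (h : (a, b) ∈ Ω) : Rfun (a, b) ≤ 20 ∨ Rfun (a, b) ≤ 4 / a ∨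
    (0 < b ∧ 1 - b * phi < a ∧ Rfun (a, b) ≤ 4 / b) := by
  obtain ⟨h1, h2, h3, h4⟩ := id h
  simp only at h1 h2 h3 h4
  have p1 := phi_gt
  have p2 := phi_lt
  have e := phib_eq
  have e2 := phi_sq
  rcases rfun_cases h with ⟨k1, k2, k3, hR⟩ | ⟨k1, k2, k3, k4, hR⟩ | ⟨k1, k2, k3, hR⟩
  · right
    rcases le_total a 0.3 with ha | ha
    · left
      rw [hR, div_le_div_iff₀ (by positivity) h1]
      have : 0.25 ≤ b := by nlinarith
      nlinarith
    · right
      refine ⟨k3, ?_, ?_⟩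
      · have := mul_lt_mul_of_pos_right k1 phi_pos
        rw [e] at this
        nlinarith
      · rw [hR, div_le_div_iff₀ (by positivity) k3]
        nlinarith
  · left
    have ha : 0.3 ≤ a := by rw [e] at k2; nlinarith
    have hb : 0.3 ≤ a + b * phi := by
      rw [e] at k1
      nlinarith [mul_lt_mul_of_pos_right k1 phi_pos]
    rw [hR, div_le_iff₀ (by positivity)]
    nlinarith [mul_le_mul ha hb (by norm_num) h1.le]
  · left
    have ha : 0.3 ≤ a := by
      rw [e] at k1; nlinarith
    have hb : 0.3 ≤ a + b := by nlinarith
    rw [hR, div_le_iff₀ (by positivity)]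
    nlinarith [mul_le_mul ha hb (by norm_num) h1.le]

/-- The part of a cusp neighbourhood over a thin triangle. -/
def cuspSet : Set ((ℝ × ℝ) × ℝ) := {x | 0 < x.1.1 ∧ x.1.1 ≤ 1 ∧ 1 - x.1.1 * phi < x.1.2 ∧
  x.1.2 ≤ 1 ∧ -(4 / x.1.1) < x.2 ∧ x.2 ≤ 0}

lemma volume_cuspSet_ne_top : volume cuspSet ≠ ⊤ := by
  have h := (measurePreserving_prodAssoc (volume : Measure ℝ) (volume : Measure ℝ)
    (volume : Measure ℝ)).symm
  have hm : MeasurableSet cuspSet := by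
    have e : cuspSet = {x | 0 < x.1.1} ∩ {x | x.1.1 ≤ 1} ∩ {x | 1 - x.1.1 * phi < x.1.2} ∩
        {x | x.1.2 ≤ 1} ∩ {x | -(4 / x.1.1) < x.2} ∩ {x | x.2 ≤ 0} := by
      ext x; simp [cuspSet, and_assoc]
    rw [e]
    exact (((((measurableSet_lt (by fun_prop) (by fun_prop)).inter
      (measurableSet_le (by fun_prop) (by fun_prop))).inter
      (measurableSet_lt (by fun_prop) (by fun_prop))).inter
      (measurableSet_le (by fun_prop) (by fun_prop))).inter
      (measurableSet_lt (by fun_prop) (by fun_prop))).inter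
      (measurableSet_le (by fun_prop) (by fun_prop))
  have h2 := h.measure_preimage hm.nullMeasurableSet
  rw [Measure.volume_eq_prod, Measure.volume_eq_prod, ← h2,
    Measure.prod_apply (h.measurable hm)]
  refine ne_top_of_le_ne_top (b := ∫⁻ a in Set.Ioc (0 : ℝ) 1, ENNReal.ofReal (4 * phi)) ?_ ?_
  · rw [setLIntegral_const]
    exact ENNReal.mul_ne_top ENNReal.ofReal_ne_top (by simp)
  rw [← lintegral_indicator measurableSet_Ioc]
  refine lintegral_mono fun a => ?_
  by_cases ha : a ∈ Set.Ioc (0 : ℝ) 1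
  · rw [Set.indicator_of_mem ha]
    have hsub : Prod.mk a ⁻¹' (MeasurableEquiv.prodAssoc.symm ⁻¹' cuspSet) ⊆
        Set.Ioc (1 - a * phi) 1 ×ˢ Set.Ioc (-(4 / a)) 0 := by
      rintro ⟨b, s⟩ ⟨_, _, h3, h4, h5, h6⟩
      exact ⟨⟨h3, h4⟩, h5, h6⟩
    refine (measure_mono hsub).trans ?_
    rw [Measure.prod_prod, Real.volume_Ioc, Real.volume_Ioc, ← ENNReal.ofReal_mul]
    · refine ENNReal.ofReal_le_ofReal (le_of_eq ?_)
      have := ha.1.ne'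
      field_simp
      ring
    · have := mul_pos ha.1 phi_pos
      linarith
  · have hsub : Prod.mk a ⁻¹' (MeasurableEquiv.prodAssoc.symm ⁻¹' cuspSet) = ∅ := by
      rw [Set.eq_empty_iff_forall_notMem]
      rintro ⟨b, s⟩ ⟨h1, h2, _⟩
      exact ha ⟨h1, h2⟩
    rw [hsub]
    simp

lemma volume_suspension_ne_top : volume suspension ≠ ⊤ := by
  have hs : MeasurePreserving (Prod.map Prod.swap id : (ℝ × ℝ) × ℝ → (ℝ × ℝ) × ℝ) volume volume :=
    Measure.measurePreserving_swap.prod (MeasurePreserving.id _)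
  have hsub : suspension ⊆ (Set.Icc (0, -1) (1, 1)) ×ˢ Set.Icc (-20) 0 ∪ cuspSet ∪
      Prod.map Prod.swap id ⁻¹' cuspSet := by
    rintro ⟨⟨a, b⟩, s⟩ ⟨h1, h2, h3⟩
    simp only at h1 h2 h3
    obtain ⟨k1, k2, k3, k4⟩ := id h1
    simp only at k1 k2 k3 k4
    rcases rfun_bounds h1 with h | h | ⟨h4, h5, h⟩
    · refine Or.inl (Or.inl ⟨⟨⟨k1.le, ?_⟩, k2, k4⟩, ?_, h3⟩)
      · simp only; nlinarith [phi_lt]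
      · simp only; linarith
    · exact Or.inl (Or.inr ⟨k1, k2, k3, k4, by simp only; linarith, h3⟩)
    · exact Or.inr ⟨h4, k4, h5, k2, by simp only [Prod.map, Prod.swap, id]; linarith, h3⟩
  refine ne_top_of_le_ne_top ?_ (measure_mono hsub)
  refine ne_top_of_le_ne_top ?_ (measure_union_le _ _)
  have h3 : volume (Prod.map Prod.swap id ⁻¹' cuspSet) ≠ ⊤ :=
    ne_top_of_le_ne_top volume_cuspSet_ne_top (hs.measure_preimage_le _)
  refine ENNReal.add_ne_top.2 ⟨?_, h3⟩
  refine ne_top_of_le_ne_top ?_ (measure_union_le _ _)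
  refine ENNReal.add_ne_top.2 ⟨?_, volume_cuspSet_ne_top⟩
  exact (isCompact_Icc.prod isCompact_Icc).measure_ne_top

lemma haarSL_fundDom_ne_top : haarSL fundDom ≠ ⊤ := by
  unfold fundDom
  rw [haarSL_preimage_coords measurableSet_suspension fun x hx => hx.1.1]
  exact ENNReal.mul_ne_top haarConst_ne_top volume_suspension_ne_top

lemma tendsto_sl2 {ι : Type*} {l : Filter ι} {u : ι → SL2} {h : SL2}
    (h0 : Tendsto (fun i => (u i).1 0 0) l (𝓝 (h.1 0 0)))
    (h1 : Tendsto (fun i => (u i).1 0 1) l (𝓝 (h.1 0 1)))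
    (h2 : Tendsto (fun i => (u i).1 1 0) l (𝓝 (h.1 1 0)))
    (h3 : Tendsto (fun i => (u i).1 1 1) l (𝓝 (h.1 1 1))) : Tendsto u l (𝓝 h) :=
  isClosedEmbedding_rows.isInducing.tendsto_nhds_iff.2
    ((h0.prodMk_nhds h1).prodMk_nhds (h2.prodMk_nhds h3))

/-- Upper unipotent matrices. -/
def upperSL (x : ℝ) : SL2 := ⟨!![1, x; 0, 1], by norm_num [Matrix.det_fin_two_of]⟩

/-- Lower unipotent matrices. -/
def lowerSL (y : ℝ) : SL2 := ⟨!![1, 0; y, 1], by norm_num [Matrix.det_fin_two_of]⟩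

/-- The diagonal matrix with entries `L⁻¹, L`. -/
def diagSL (L : ℝ) : SL2 :=
  if h : L = 0 then 1 else ⟨!![L⁻¹, 0; 0, L], by simp [Matrix.det_fin_two_of, h]⟩

@[simp] lemma upper_entries (x : ℝ) : (upperSL x).1 0 0 = 1 ∧ (upperSL x).1 0 1 = x ∧
    (upperSL x).1 1 0 = 0 ∧ (upperSL x).1 1 1 = 1 := by simp [upperSL]

@[simp] lemma lower_entries (x : ℝ) : (lowerSL x).1 0 0 = 1 ∧ (lowerSL x).1 0 1 = 0 ∧
    (lowerSL x).1 1 0 = x ∧ (lowerSL x).1 1 1 = 1 := by simp [lowerSL]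

lemma diagSL_entries {L : ℝ} (h : L ≠ 0) : (diagSL L).1 0 0 = L⁻¹ ∧ (diagSL L).1 0 1 = 0 ∧
    (diagSL L).1 1 0 = 0 ∧ (diagSL L).1 1 1 = L := by simp [diagSL, h]

lemma upper_add (x y : ℝ) : upperSL (x + y) = upperSL x * upperSL y := by
  apply sl2_ext <;> simp only [sl2_mul, upper_entries] <;> ring

lemma upper_natCast (k : ℕ) : upperSL k = upperSL 1 ^ k := by
  induction k with
  | zero =>
    rw [pow_zero]
    apply sl2_ext <;> simp
  | succ k ih => push_cast; rw [upper_add, ih, pow_succ]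

lemma upper_neg (x : ℝ) : upperSL (-x) = (upperSL x)⁻¹ := by
  rw [eq_inv_iff_mul_eq_one, ← upper_add, neg_add_cancel]
  apply sl2_ext <;> simp

lemma diagSL_two_pow (n : ℕ) : diagSL (2 ^ n) = diagSL 2 ^ n := by
  induction n with
  | zero =>
    rw [pow_zero, pow_zero]
    have := diagSL_entries (one_ne_zero (α := ℝ))
    apply sl2_ext <;> simp [this]
  | succ n ih =>
    rw [pow_succ (diagSL 2) n, ← ih]
    have h1 := diagSL_entries (two_ne_zero (α := ℝ))
    have h2 := diagSL_entries (pow_ne_zero n (two_ne_zero (α := ℝ)))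
    have h3 := diagSL_entries (pow_ne_zero (n + 1) (two_ne_zero (α := ℝ)))
    apply sl2_ext <;> simp only [sl2_mul, h1, h2, h3] <;> ring

lemma diagSL_conj_upper {L : ℝ} (hL : L ≠ 0) (x : ℝ) :
    diagSL L * upperSL x * (diagSL L)⁻¹ = upperSL (x / L ^ 2) := by
  have h := diagSL_entries hL
  apply sl2_ext <;> simp only [sl2_mul, h, upper_entries, sl2_inv] <;> field_simp <;> ring

lemma diagSL_conj_lower {L : ℝ} (hL : L ≠ 0) (x : ℝ) :
    (diagSL L)⁻¹ * lowerSL x * diagSL L = lowerSL (x / L ^ 2) := by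
  have h := diagSL_entries hL
  apply sl2_ext <;> simp only [sl2_mul, h, lower_entries, sl2_inv] <;> field_simp <;> ring

lemma tendsto_upper {ι : Type*} {l : Filter ι} {x : ι → ℝ} (h : Tendsto x l (𝓝 0)) :
    Tendsto (fun i => upperSL (x i)) l (𝓝 1) := by
  apply tendsto_sl2 <;> simp [h, tendsto_const_nhds]

lemma tendsto_lower {ι : Type*} {l : Filter ι} {x : ι → ℝ} (h : Tendsto x l (𝓝 0)) :
    Tendsto (fun i => lowerSL (x i)) l (𝓝 1) := by
  apply tendsto_sl2 <;> simp [h, tendsto_const_nhds]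

/-- **Mautner phenomenon**: a subgroup of `SL(2,ℝ)` which contains every limit of `aᵢ uᵢ bᵢ` with
`aᵢ, bᵢ` in the subgroup and `uᵢ → 1`, and contains a unipotent element, is everything. -/
lemma mautner (S : Subgroup SL2) (hS : ∀ (a u b : ℕ → SL2) (h : SL2), (∀ i, a i ∈ S) →
    (∀ i, b i ∈ S) → Tendsto u atTop (𝓝 1) → Tendsto (fun i => a i * u i * b i) atTop (𝓝 h) →
    h ∈ S) (h1 : upperSL 1 ∈ S) (g : SL2) : g ∈ S := by
  have hk : ∀ k : ℕ, upperSL k ∈ S := fun k => by rw [upper_natCast]; exact pow_mem h1 k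
  have hinv : Tendsto (fun i : ℕ => ((2 : ℝ) * (i + 1))⁻¹) atTop (𝓝 0) := by
    have h := (tendsto_one_div_add_atTop_nhds_zero_nat (𝕜 := ℝ)).const_mul 2⁻¹
    rw [mul_zero] at h
    refine h.congr fun i => ?_
    rw [mul_inv, one_div]
  have hd : diagSL (2⁻¹) ∈ S := by
    refine hS (fun i => upperSL ((2 * (i + 1) : ℕ) : ℝ)) (fun i => lowerSL ((2 * (i + 1) : ℝ)⁻¹))
      (fun i => (upperSL ((i + 1 : ℕ) : ℝ))⁻¹) _ (fun i => hk _) (fun i => inv_mem (hk _))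
      (tendsto_lower hinv) ?_
    have hd := diagSL_entries (inv_ne_zero (two_ne_zero (α := ℝ)))
    apply tendsto_sl2 <;> simp only [sl2_mul, upper_entries, lower_entries, sl2_inv, hd]
    · refine tendsto_const_nhds.congr fun i => ?_
      have : (i : ℝ) + 1 ≠ 0 := by positivity
      push_cast
      field_simp
      ring
    · refine tendsto_const_nhds.congr fun i => ?_
      have : (i : ℝ) + 1 ≠ 0 := by positivity
      push_cast
      field_simp
      ring
    · simpa using hinv
    · refine tendsto_const_nhds.congr fun i => ?_
      have : (i : ℝ) + 1 ≠ 0 := by positivity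
      push_cast
      field_simp
      norm_num
  have hd2 : ∀ n : ℕ, diagSL (2 ^ n) ∈ S := by
    intro n
    rw [diagSL_two_pow]
    refine pow_mem ?_ n
    have : diagSL 2 = (diagSL (2⁻¹))⁻¹ := by
      have h1 := diagSL_entries (two_ne_zero (α := ℝ))
      have h2 := diagSL_entries (inv_ne_zero (two_ne_zero (α := ℝ)))
      apply sl2_ext <;> simp [sl2_inv, h1, h2]
    rw [this]
    exact inv_mem hd
  have hlim : ∀ x : ℝ, Tendsto (fun n : ℕ => x / (2 ^ n) ^ 2) atTop (𝓝 0) := by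
    intro x
    have h := (tendsto_pow_atTop_nhds_zero_of_lt_one (r := (1 / 4 : ℝ)) (by norm_num)
      (by norm_num)).const_mul x
    rw [mul_zero] at h
    refine h.congr fun n => ?_
    rw [_root_.one_div_pow, ← pow_mul, mul_comm n 2, pow_mul]
    norm_num
    rfl
  have hU : ∀ x, upperSL x ∈ S := fun x => by
    refine hS (fun n => (diagSL (2 ^ n))⁻¹) (fun n => upperSL (x / (2 ^ n) ^ 2))
      (fun n => diagSL (2 ^ n)) _ (fun n => inv_mem (hd2 n)) hd2 (tendsto_upper (hlim x)) ?_
    refine tendsto_const_nhds.congr fun n => ?_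
    rw [← diagSL_conj_upper (by positivity)]
    group
  have hL : ∀ x, lowerSL x ∈ S := fun x => by
    refine hS (fun n => diagSL (2 ^ n)) (fun n => lowerSL (x / (2 ^ n) ^ 2))
      (fun n => (diagSL (2 ^ n))⁻¹) _ hd2 (fun n => inv_mem (hd2 n)) (tendsto_lower (hlim x)) ?_
    refine tendsto_const_nhds.congr fun n => ?_
    rw [← diagSL_conj_lower (by positivity)]
    group
  have key : ∀ g : SL2, g.1 1 0 ≠ 0 → g ∈ S := by
    intro g hg
    have e : g = upperSL ((g.1 0 0 - 1) / g.1 1 0) * lowerSL (g.1 1 0) *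
        upperSL ((g.1 1 1 - 1) / g.1 1 0) := by
      have hdet := sl2_det g
      apply sl2_ext <;> simp only [sl2_mul, upper_entries, lower_entries] <;> field_simp
      · ring
      · linear_combination -hdet
      · ring
      · ring
    rw [e]
    exact mul_mem (mul_mem (hU _) (hL _)) (hU _)
  by_cases hg : g.1 1 0 = 0
  · have hdet := sl2_det g
    have e : g = (lowerSL 1)⁻¹ * (lowerSL 1 * g) := by group
    rw [e]
    refine mul_mem (inv_mem (hL 1)) (key _ ?_)
    simp only [sl2_mul, lower_entries]
    rw [hg] at hdet ⊢
    intro h0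
    simp at h0
    rw [h0] at hdet
    simp at hdet
  · exact key g hg

/-- A pointwise limit of equi-Lipschitz functionals is attained on a closed set. -/
lemma isClosed_setOf_tendsto {E ι : Type*} [PseudoMetricSpace E] {l : Filter ι} {T : ι → E → ℝ}
    {T0 : E → ℝ} {C : ℝ} (hT : ∀ i x y, |T i x - T i y| ≤ C * dist x y)
    (hT0 : ∀ x y, |T0 x - T0 y| ≤ C * dist x y) :
    IsClosed {x | Tendsto (fun i => T i x) l (𝓝 (T0 x))} := by
  refine isClosed_of_closure_subset fun x hx => ?_
  refine Metric.tendsto_nhds.2 fun ε hε => ?_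
  have hC : 0 < |C| + 1 := by positivity
  obtain ⟨y, hy, hxy⟩ := Metric.mem_closure_iff.1 hx (ε / 3 / (|C| + 1)) (by positivity)
  have hb : C * dist x y ≤ ε / 3 := by
    have := (lt_div_iff₀ hC).1 hxy
    nlinarith [le_abs_self C, dist_nonneg (x := x) (y := y)]
  filter_upwards [Metric.tendsto_nhds.1 hy (ε / 3) (by positivity)] with i hi
  rw [Real.dist_eq] at hi ⊢
  have h1 := (hT i x y).trans hb
  have h2 := (hT0 x y).trans hb
  rw [abs_le] at h1 h2
  rw [abs_lt] at hi ⊢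
  constructor <;> linarith [h1.1, h1.2, h2.1, h2.2, hi.1, hi.2]

/-- The homogeneous space `SL(2,ℝ)/Γ`. -/
abbrev QX : Type := SL2 ⧸ Γ

/-- The projection to the homogeneous space. -/
def projQX (g : SL2) : QX := QuotientGroup.mk g

lemma measurable_projQX : Measurable projQX :=
  (QuotientGroup.continuous_mk : Continuous (QuotientGroup.mk : SL2 → QX)).measurable

/-- The finite invariant measure on the homogeneous space. -/
def muQX : Measure QX := (haarSL.restrict fundDom).map projQX

instance : IsFiniteMeasure muQX := by
  have : IsFiniteMeasure (haarSL.restrict fundDom) :=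
    ⟨by rw [Measure.restrict_apply_univ]; exact haarSL_fundDom_ne_top.lt_top⟩
  unfold muQX
  infer_instance

lemma absolutelyContinuous_muQX : haarSL.map projQX ≪ muQX :=
  isFundamentalDomain_fundDom.absolutelyContinuous_map

instance : HasFundamentalDomain Γ.op SL2 haarSL := ⟨fundDom, isFundamentalDomain_fundDom⟩

instance : SMulInvariantMeasure SL2 QX muQX := by
  have : QuotientMeasureEqMeasurePreimage haarSL muQX :=
    isFundamentalDomain_fundDom.quotientMeasureEqMeasurePreimage rfl
  exact QuotientMeasureEqMeasurePreimage.smulInvariantMeasure_quotient haarSL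

instance : ErgodicSMul SL2 QX muQX where
  aeconst_of_forall_preimage_smul_ae_eq := by
    intro s hs h
    have hs' : MeasurableSet (projQX ⁻¹' s) := measurable_projQX hs
    have key : EventuallyConst (projQX ⁻¹' s) (ae haarSL) := by
      refine ErgodicSMul.aeconst_of_forall_preimage_smul_ae_eq (G := SL2) hs' fun g => ?_
      exact ae_eq_comp (f := projQX) (g := (g • · : QX → QX) ⁻¹' s) (g' := s)
        measurable_projQX.aemeasurable (absolutelyContinuous_muQX (h g))
    rw [eventuallyConst_set] at key ⊢
    unfold muQX
    exact key.imp
      (fun h => (ae_map_iff measurable_projQX.aemeasurable hs).2 (ae_restrict_of_ae h))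
      fun h => (ae_map_iff measurable_projQX.aemeasurable hs.compl).2 (ae_restrict_of_ae h)

instance : Fact ((2 : ENNReal) ≠ ⊤) := ⟨ENNReal.ofNat_ne_top⟩

instance : ContinuousSMul SL2ᵈᵐᵃ (Lp ℝ 2 muQX) := 
  Lp.instContinuousSMulDomMulAct (M := SL2) (X := QX) (μ := muQX) (E := ℝ) (p := 2)

open DomMulAct in
lemma exists_ae_const_of_smul_eq {f : Lp ℝ 2 muQX} (hf : ∀ g : SL2, mk g • f = f) :
    ∃ c : ℝ, f =ᵐ[muQX] fun _ => c := by
  refine exists_eventuallyEq_const_of_forall_separating MeasurableSet fun U hU => ?_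
  have h := ErgodicSMul.aeconst_of_forall_preimage_smul_ae_eq (G := SL2) (μ := muQX)
    ((Lp.stronglyMeasurable f).measurable hU) fun g => ?_
  · exact eventuallyConst_set.1 h
  · have h1 := smul_Lp_ae_eq (mk g) f
    rw [hf g] at h1
    filter_upwards [h1] with x hx
    change (f (g • x) ∈ U) = (f x ∈ U)
    rw [hx]
    rfl

open DomMulAct in
lemma smul_eq_of_upperSL {f : Lp ℝ 2 muQX} (hf : mk (upperSL 1) • f = f) (g : SL2) :
    mk g • f = f := by
  let S : Subgroup SL2 :=
    { carrier := {g | mk g • f = f}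
      one_mem' := by simp
      mul_mem' := fun {a b} ha hb => by
        change mk (a * b) • f = f
        rw [mk_mul, mul_smul, ha, hb]
      inv_mem' := fun {a} ha => by
        change mk a⁻¹ • f = f
        rw [mk_inv, inv_smul_eq_iff]
        exact ha.symm }
  refine mautner S (fun a u b h ha hb hu hlim => ?_) hf g
  have h1 : Tendsto (fun i => dist (mk (u i) • f) f) atTop (𝓝 0) := by
    have := ((continuous_mk.tendsto _).comp hu).smul_const f
    rw [mk_one, one_smul] at this
    exact tendsto_iff_dist_tendsto_zero.1 this
  have h2 : Tendsto (fun i => dist (mk (a i * u i * b i) • f) f) atTop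
      (𝓝 (dist (mk h • f) f)) :=
    (((continuous_mk.tendsto _).comp hlim).smul_const f).dist tendsto_const_nhds
  have h3 : ∀ i, dist (mk (a i * u i * b i) • f) f = dist (mk (u i) • f) f := by
    intro i
    have ha' : mk (a i) • f = f := ha i
    have hb' : mk (b i) • f = f := hb i
    rw [mk_mul, mk_mul, mul_smul, mul_smul, ha']
    conv_lhs => rw [← hb', ← mul_smul]
    rw [hb']
    conv_lhs => arg 2; rw [← hb']
    rw [mul_smul, dist_smul_Lp]
  simp_rw [h3] at h2
  exact dist_eq_zero.1 (tendsto_nhds_unique h2 h1)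

open DomMulAct in
lemma inner_smul_smul (g : SL2ᵈᵐᵃ) (f h : Lp ℝ 2 muQX) :
    inner ℝ (g • f) (g • h) = inner ℝ f h := by
  rw [real_inner_eq_norm_add_mul_self_sub_norm_mul_self_sub_norm_mul_self_div_two,
    real_inner_eq_norm_add_mul_self_sub_norm_mul_self_sub_norm_mul_self_div_two,
    ← smul_Lp_add, norm_smul_Lp, norm_smul_Lp, norm_smul_Lp]

/-- The constant function one. -/
def oneLp : Lp ℝ 2 muQX := indicatorConstLp 2 MeasurableSet.univ (measure_ne_top _ _) 1

lemma inner_oneLp (f : Lp ℝ 2 muQX) : inner ℝ oneLp f = ∫ x, f x ∂muQX := by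
  rw [oneLp, L2.inner_indicatorConstLp_one, setIntegral_univ]

open DomMulAct in
lemma smul_oneLp (g : SL2ᵈᵐᵃ) : g • oneLp = oneLp := by
  obtain ⟨g, rfl⟩ := mk.surjective g
  simp only [oneLp, mk_smul_indicatorConstLp, Set.preimage_univ]

open DomMulAct in
/-- Decay of matrix coefficients along the diagonal group. -/
lemma tendsto_inner_diagSL (f h : Lp ℝ 2 muQX) :
    Tendsto (fun L => inner ℝ (mk (diagSL L) • f) h) atTop
      (𝓝 (inner ℝ oneLp f / muQX.real Set.univ * inner ℝ oneLp h)) := by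
  let W : Submodule ℝ (Lp ℝ 2 muQX) :=
    { carrier := {h | Tendsto (fun L => inner ℝ (mk (diagSL L) • f) h) atTop
        (𝓝 (inner ℝ oneLp f / muQX.real Set.univ * inner ℝ oneLp h))}
      zero_mem' := by simp
      add_mem' := fun {a b} ha hb => by
        have := Tendsto.add ha hb
        simpa only [Set.mem_ofPred_eq, inner_add_right, mul_add] using this
      smul_mem' := fun c a ha => by
        have := Tendsto.const_mul c ha
        simp only [Set.mem_ofPred_eq, inner_smul_right]
        convert this using 2
        ring }
  have hcl : IsClosed (W : Set (Lp ℝ 2 muQX)) := by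
    refine isClosed_setOf_tendsto (C := ‖f‖ + |inner ℝ oneLp f / muQX.real Set.univ| * ‖oneLp‖)
      (fun L x y => ?_) fun x y => ?_
    · rw [← inner_sub_right, dist_eq_norm]
      refine (abs_real_inner_le_norm _ _).trans ?_
      rw [norm_smul_Lp]
      gcongr
      have : 0 ≤ |inner ℝ oneLp f / muQX.real Set.univ| * ‖oneLp‖ := by positivity
      linarith
    · rw [← mul_sub, ← inner_sub_right, abs_mul, dist_eq_norm, add_mul, mul_assoc]
      have h1 := abs_real_inner_le_norm oneLp (x - y)
      have h2 : 0 ≤ ‖f‖ * ‖x - y‖ := by positivity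
      have := mul_le_mul_of_nonneg_left h1 (abs_nonneg (inner ℝ oneLp f / muQX.real Set.univ))
      linarith
  have hone : oneLp ∈ W := by
    refine tendsto_const_nhds.congr fun L => ?_
    have h1 : inner ℝ oneLp oneLp = muQX.real Set.univ := by
      rw [oneLp, L2.inner_indicatorConstLp_indicatorConstLp]
      simp
    rw [h1]
    conv_rhs => rw [← smul_oneLp (mk (diagSL L)), inner_smul_smul, real_inner_comm]
    by_cases hV : muQX.real Set.univ = 0
    · rw [hV] at h1 ⊢
      rw [inner_self_eq_zero.1 h1]
      simp
    · field_simp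
  have hcob : ∀ h', mk (upperSL 1) • h' - h' ∈ W := by
    intro h'
    have h0 : inner ℝ oneLp (mk (upperSL 1) • h' - h') = 0 := by
      rw [inner_sub_right]
      nth_rewrite 1 [← smul_oneLp (mk (upperSL 1))]
      rw [inner_smul_smul, sub_self]
    change Tendsto _ _ _
    rw [h0, mul_zero]
    have hu : Tendsto (fun L : ℝ => upperSL (-1 / L ^ 2)) atTop (𝓝 1) :=
      tendsto_upper (tendsto_const_nhds.div_atTop (tendsto_pow_atTop two_ne_zero))
    have h1 : Tendsto (fun L : ℝ => ‖mk (upperSL (-1 / L ^ 2)) • f - f‖ * ‖h'‖) atTop (𝓝 0) := by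
      have := ((continuous_mk.tendsto _).comp hu).smul_const f
      rw [mk_one, one_smul] at this
      simpa using (tendsto_iff_norm_sub_tendsto_zero.1 this).mul_const ‖h'‖
    refine squeeze_zero_norm' ?_ h1
    filter_upwards [eventually_gt_atTop 0] with L hL
    have e : inner ℝ (mk (diagSL L) • f) (mk (upperSL 1) • h' - h') =
        inner ℝ (mk (diagSL L) • (mk (upperSL (-1 / L ^ 2)) • f - f)) h' := by
      rw [inner_sub_right, smul_Lp_sub, inner_sub_left]
      congr 1
      rw [← inner_smul_smul (mk (upperSL (-1))) _ (mk (upperSL 1) • h'), ← mul_smul, ← mul_smul,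
        ← mul_smul, ← mk_mul, ← mk_mul, ← mk_mul, upper_neg, mul_inv_cancel, mk_one, one_smul,
        ← upper_neg, ← diagSL_conj_upper hL.ne', inv_mul_cancel_right]
    rw [e]
    refine (norm_inner_le_norm _ _).trans ?_
    rw [norm_smul_Lp]
  have htop : W = ⊤ := by
    have := hcl.completeSpace_coe
    rw [← Submodule.orthogonal_eq_bot_iff, Submodule.eq_bot_iff]
    intro v hv
    rw [Submodule.mem_orthogonal'] at hv
    have h1 : mk (upperSL 1) • v = v := by
      have h2 : ∀ h', inner ℝ v (mk (upperSL 1) • h') = inner ℝ v h' := by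
        intro h'
        have := hv _ (hcob h')
        rw [inner_sub_right] at this
        linarith
      have h3 := h2 v
      rw [← sub_eq_zero, ← inner_self_eq_zero (𝕜 := ℝ)]
      have h5 : inner ℝ (mk (upperSL 1) • v) v = inner ℝ v v := (real_inner_comm _ _).trans h3
      rw [inner_sub_left, inner_sub_right, inner_sub_right, inner_smul_smul, h3, h5]
      ring
    obtain ⟨c, hc⟩ := exists_ae_const_of_smul_eq (smul_eq_of_upperSL h1)
    have h4 := hv _ hone
    rw [real_inner_comm, inner_oneLp, integral_congr_ae hc, integral_const, smul_eq_mul,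
      mul_eq_zero] at h4
    rw [Lp.eq_zero_iff_ae_eq_zero]
    rcases h4 with h4 | h4
    · rw [measureReal_eq_zero_iff, Measure.measure_univ_eq_zero] at h4
      have h5 : ae muQX = ⊥ := ae_eq_bot.2 h4
      simp [EventuallyEq, h5]
    · rw [h4] at hc; exact hc
  have : h ∈ W := htop ▸ Submodule.mem_top
  exact this

lemma tendsto_measure_inter_diagSL {E s : Set QX} (hE : MeasurableSet E) (hs : MeasurableSet s) :
    Tendsto (fun L => muQX.real ((fun x => diagSL L • x) ⁻¹' E ∩ s)) atTop
      (𝓝 (muQX.real E / muQX.real Set.univ * muQX.real s)) := by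
  have h := tendsto_inner_diagSL (indicatorConstLp 2 hE (measure_ne_top _ _) 1)
    (indicatorConstLp 2 hs (measure_ne_top _ _) 1)
  simp only [DomMulAct.mk_smul_indicatorConstLp, oneLp,
    L2.real_inner_indicatorConstLp_one_indicatorConstLp_one, Set.univ_inter] at h
  exact h

lemma measurableSet_smul_preimage {E : Set QX} (hE : MeasurableSet E) (g : SL2) :
    MeasurableSet ((fun x => g • x) ⁻¹' E) :=
  hE.preimage (continuous_const_smul g).measurable

lemma tendsto_setIntegral_diagSL {E : Set QX} (hE : MeasurableSet E) {k : QX → ℝ}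
    (hk : Integrable k muQX) :
    Tendsto (fun L => ∫ x in (fun x => diagSL L • x) ⁻¹' E, k x ∂muQX) atTop
      (𝓝 (muQX.real E / muQX.real Set.univ * ∫ x, k x ∂muQX)) := by
  refine Integrable.induction (P := fun k => Tendsto
    (fun L => ∫ x in (fun x => diagSL L • x) ⁻¹' E, k x ∂muQX) atTop
      (𝓝 (muQX.real E / muQX.real Set.univ * ∫ x, k x ∂muQX)))
    (fun c s hs _ => ?_) (fun f g _ hf hg h1 h2 => ?_) ?_ (fun f g hfg _ h => ?_) hk
  · have h := (tendsto_measure_inter_diagSL hE hs).mul_const c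
    rw [mul_assoc] at h
    simp only [setIntegral_indicator hs]
    simpa only [setIntegral_const, integral_indicator_const c hs, smul_eq_mul] using h
  · have h := h1.add h2
    rw [← mul_add, ← integral_add hf hg] at h
    refine h.congr fun L => ?_
    rw [← integral_add hf.integrableOn hg.integrableOn]
    rfl
  · have key : ∀ (S : Set QX) (f g : Lp ℝ 1 muQX),
        |∫ x in S, f x ∂muQX - ∫ x in S, g x ∂muQX| ≤ dist f g := by
      intro S f g
      rw [← integral_sub (L1.integrable_coeFn f).integrableOn (L1.integrable_coeFn g).integrableOn,
        L1.dist_eq_integral_dist]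
      refine (abs_integral_le_integral_abs).trans ?_
      simp_rw [← Real.dist_eq]
      refine setIntegral_le_integral ?_ (ae_of_all _ fun x => dist_nonneg)
      simp_rw [dist_eq_norm]
      exact ((L1.integrable_coeFn f).sub (L1.integrable_coeFn g)).norm
    refine isClosed_setOf_tendsto (C := 1 + |muQX.real E / muQX.real Set.univ|)
      (fun L f g => (key _ f g).trans ?_) fun f g => ?_
    · nlinarith [abs_nonneg (muQX.real E / muQX.real Set.univ), dist_nonneg (x := f) (y := g)]
    · rw [← mul_sub, abs_mul]
      have := key Set.univ f g
      simp only [setIntegral_univ] at this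
      nlinarith [mul_le_mul_of_nonneg_left this (abs_nonneg (muQX.real E / muQX.real Set.univ)),
        dist_nonneg (x := f) (y := g)]
  · rw [← integral_congr_ae hfg]
    exact h.congr fun L => integral_congr_ae (ae_restrict_of_ae hfg)

/-- Equidistribution of expanding translates of an absolutely continuous measure. -/
lemma tendsto_measure_diagSL {lam : Measure SL2} [IsFiniteMeasure lam] (hlam : lam ≪ haarSL)
    {E : Set QX} (hE : MeasurableSet E) :
    Tendsto (fun L => lam.real {g | projQX (diagSL L * g) ∈ E}) atTop
      (𝓝 (muQX.real E / muQX.real Set.univ * lam.real Set.univ)) := by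
  have hac : lam.map projQX ≪ muQX :=
    (hlam.map measurable_projQX).trans absolutelyContinuous_muQX
  have h := tendsto_setIntegral_diagSL hE
    (Measure.integrable_toReal_rnDeriv (μ := lam.map projQX) (ν := muQX))
  simp only [Measure.setIntegral_toReal_rnDeriv hac, Measure.integral_toReal_rnDeriv hac] at h
  rw [map_measureReal_apply measurable_projQX MeasurableSet.univ, Set.preimage_univ] at h
  refine h.congr fun L => ?_
  rw [map_measureReal_apply measurable_projQX (measurableSet_smul_preimage hE _)]
  rfl

/-- The part of the suspension with heights in `(-1, 0]` above a set `D`. -/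
def boxSet (D : Set (ℝ × ℝ)) : Set SL2 := coords ⁻¹' (D ×ˢ Set.Ioc (-1) 0)

lemma boxSet_subset {D : Set (ℝ × ℝ)} (hD : D ⊆ Ω) : boxSet D ⊆ fundDom := by
  intro g hg
  obtain ⟨h1, h2, h3⟩ := hg
  have h4 : 1 ≤ Rfun (coords g).1 := one_le_rfun (hD h1)
  exact ⟨hD h1, by linarith, h3⟩

lemma measurableSet_boxSet {D : Set (ℝ × ℝ)} (hD : MeasurableSet D) :
    MeasurableSet (boxSet D) := measurable_coords (hD.prod measurableSet_Ioc)

/-- The image of `boxSet D` in the homogeneous space. -/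
def boxClass (D : Set (ℝ × ℝ)) : Set QX := projQX '' boxSet D

lemma projQX_eq_iff {g h : SL2} : projQX g = projQX h ↔ ∃ γ ∈ Γ, h = g * γ := by
  unfold projQX
  rw [QuotientGroup.eq]
  constructor
  · intro h'
    exact ⟨_, h', by group⟩
  · rintro ⟨γ, hγ, rfl⟩
    rwa [inv_mul_cancel_left]

lemma mem_boxClass {D : Set (ℝ × ℝ)} {g : SL2} :
    projQX g ∈ boxClass D ↔ ∃ γ ∈ Γ, g * γ ∈ boxSet D := by
  constructor
  · rintro ⟨h, hh, e⟩
    obtain ⟨γ, hγ, rfl⟩ := projQX_eq_iff.1 e.symm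
    exact ⟨γ, hγ, hh⟩
  · rintro ⟨γ, hγ, h⟩
    exact ⟨_, h, (projQX_eq_iff.2 ⟨γ, hγ, rfl⟩).symm⟩

lemma injOn_projQX : Set.InjOn projQX fundDom := by
  intro g hg h hh e
  obtain ⟨γ, hγ, rfl⟩ := projQX_eq_iff.1 e
  rw [fundDom_unique hγ hg hh, mul_one]

lemma measurableSet_boxClass {D : Set (ℝ × ℝ)} (hD : MeasurableSet D) (hDΩ : D ⊆ Ω) :
    MeasurableSet (boxClass D) :=
  (measurableSet_boxSet hD).image_of_measurable_injOn measurable_projQX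
    (injOn_projQX.mono (boxSet_subset hDΩ))

lemma muQX_boxClass {D : Set (ℝ × ℝ)} (hD : MeasurableSet D) (hDΩ : D ⊆ Ω) :
    muQX (boxClass D) = haarConst * volume D := by
  rw [muQX, Measure.map_apply measurable_projQX (measurableSet_boxClass hD hDΩ),
    Measure.restrict_apply' measurableSet_fundDom, boxClass,
    injOn_projQX.preimage_image_inter (boxSet_subset hDΩ)]
  unfold boxSet
  rw [haarSL_preimage_coords (hD.prod measurableSet_Ioc) fun x hx => (hDΩ hx.1).1,
    Measure.volume_eq_prod, Measure.prod_prod]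
  simp

lemma muQX_real_boxClass {D : Set (ℝ × ℝ)} (hD : MeasurableSet D) (hDΩ : D ⊆ Ω) :
    muQX.real (boxClass D) = haarConst.toReal * volume.real D := by
  rw [measureReal_def, muQX_boxClass hD hDΩ, ENNReal.toReal_mul]
  rfl

lemma continuous_lowerSL : Continuous lowerSL := by
  refine Continuous.subtype_mk (continuous_matrix fun i j => ?_) _
  fin_cases i <;> fin_cases j <;> simp <;> fun_prop

lemma measurable_mul_lowerSL : Measurable fun p : SL2 × ℝ => p.1 * lowerSL (-p.2) := by
  have := continuous_lowerSL
  exact (by fun_prop : Continuous fun p : SL2 × ℝ => p.1 * lowerSL (-p.2)).measurable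

/-- The Haar measure on an open piece, spread along horocycle arcs. -/
def arcMeasure (O : Set SL2) (I : Set ℝ) : Measure SL2 :=
  ((haarSL.restrict O).prod (volume.restrict I)).map fun p => p.1 * lowerSL (-p.2)

lemma arcMeasure_absolutelyContinuous (O : Set SL2) (I : Set ℝ) : arcMeasure O I ≪ haarSL := by
  refine Measure.AbsolutelyContinuous.mk fun N hN h0 => ?_
  unfold arcMeasure
  rw [Measure.map_apply measurable_mul_lowerSL hN,
    Measure.prod_apply_symm (measurable_mul_lowerSL hN)]
  refine (lintegral_congr fun s => ?_).trans lintegral_zero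
  refine Measure.restrict_le_self.absolutelyContinuous ?_
  exact (measure_preimage_mul_right haarSL (lowerSL (-s)) N).trans h0

lemma arcMeasure_apply (O : Set SL2) (I : Set ℝ) {S : Set SL2} (hS : MeasurableSet S) :
    arcMeasure O I S = ∫⁻ o in O, volume ({s | o * lowerSL (-s) ∈ S} ∩ I) ∂haarSL := by
  unfold arcMeasure
  rw [Measure.map_apply measurable_mul_lowerSL hS,
    Measure.prod_apply (measurable_mul_lowerSL hS)]
  refine lintegral_congr fun o => ?_
  rw [Measure.restrict_apply ((measurable_mul_lowerSL hS).preimage measurable_prodMk_left)]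
  rfl

lemma arcMeasure_univ (O : Set SL2) (I : Set ℝ) :
    arcMeasure O I Set.univ = haarSL O * volume I := by
  rw [arcMeasure_apply O I MeasurableSet.univ]
  simp [mul_comm]

section Bounds

variable {O : Set SL2} {I : Set ℝ} {E : Set QX} {f : ℝ → ℝ}

lemma tendsto_arcMeasure (hO : haarSL O ≠ ⊤) (hO0 : haarSL O ≠ 0) (hI : volume I ≠ ⊤)
    (hE : MeasurableSet E) :
    Tendsto (fun L => (arcMeasure O I).real {g | projQX (diagSL L * g) ∈ E} / haarSL.real O) atTop
      (𝓝 (muQX.real E / muQX.real Set.univ * volume.real I)) := by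
  have : IsFiniteMeasure (arcMeasure O I) :=
    ⟨by rw [arcMeasure_univ]; exact (ENNReal.mul_ne_top hO hI).lt_top⟩
  have h := (tendsto_measure_diagSL (arcMeasure_absolutelyContinuous O I) hE).div_const
    (haarSL.real O)
  have h1 : (arcMeasure O I).real Set.univ = haarSL.real O * volume.real I := by
    rw [measureReal_def, arcMeasure_univ, ENNReal.toReal_mul]; rfl
  have h2 : haarSL.real O ≠ 0 := (ENNReal.toReal_pos hO0 hO).ne'
  rw [h1] at h
  convert h using 2
  field_simp

lemma measurableSet_translate (hE : MeasurableSet E) (L : ℝ) :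
    MeasurableSet {g : SL2 | projQX (diagSL L * g) ∈ E} :=
  measurable_projQX.comp (measurable_const_mul (diagSL L)) hE

lemma eventually_lt_of_arc_le (hOm : MeasurableSet O) (hO : haarSL O ≠ ⊤) (hO0 : haarSL O ≠ 0)
    (hI : volume I ≠ ⊤) (hE : MeasurableSet E)
    (hf : ∀ᶠ L in atTop, 0 ≤ f L ∧ ∀ o ∈ O,
      volume ({s | projQX (diagSL L * (o * lowerSL (-s))) ∈ E} ∩ I) ≤ ENNReal.ofReal (f L))
    {c : ℝ} (hc : c < muQX.real E / muQX.real Set.univ * volume.real I) :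
    ∀ᶠ L in atTop, c < f L := by
  filter_upwards [hf, (tendsto_arcMeasure hO hO0 hI hE).eventually_const_lt hc] with L h1 h2
  have hpos : 0 < haarSL.real O := ENNReal.toReal_pos hO0 hO
  refine h2.trans_le ?_
  rw [div_le_iff₀ hpos]
  refine ENNReal.toReal_le_of_le_ofReal (mul_nonneg h1.1 hpos.le) ?_
  rw [arcMeasure_apply O I (measurableSet_translate hE L), ENNReal.ofReal_mul h1.1,
    ofReal_measureReal hO, ← setLIntegral_const]
  exact setLIntegral_mono' hOm h1.2

lemma eventually_lt_of_le_arc (hOm : MeasurableSet O) (hO : haarSL O ≠ ⊤) (hO0 : haarSL O ≠ 0)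
    (hI : volume I ≠ ⊤) (hE : MeasurableSet E)
    (hf : ∀ᶠ L in atTop, 0 ≤ f L ∧ ∀ o ∈ O,
      ENNReal.ofReal (f L) ≤ volume ({s | projQX (diagSL L * (o * lowerSL (-s))) ∈ E} ∩ I))
    {c : ℝ} (hc : muQX.real E / muQX.real Set.univ * volume.real I < c) :
    ∀ᶠ L in atTop, f L < c := by
  filter_upwards [hf, (tendsto_arcMeasure hO hO0 hI hE).eventually_lt_const hc] with L h1 h2
  have hpos : 0 < haarSL.real O := ENNReal.toReal_pos hO0 hO
  refine lt_of_le_of_lt ?_ h2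
  rw [le_div_iff₀ hpos]
  refine (ENNReal.ofReal_le_iff_le_toReal ?_).1 ?_
  · refine ne_top_of_le_ne_top ?_ (measure_mono (Set.subset_univ _))
    rw [arcMeasure_univ]
    exact ENNReal.mul_ne_top hO hI
  · rw [arcMeasure_apply O I (measurableSet_translate hE L), ENNReal.ofReal_mul h1.1,
      ofReal_measureReal hO, ← setLIntegral_const]
    exact setLIntegral_mono' hOm h1.2

end Bounds

lemma volume_Omega : volume Ω = ENNReal.ofReal (phi / 2) := by
  have hphi := phi_pos
  have h1 : ∀ a : ℝ, volume (Prod.mk a ⁻¹' Ω) =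
      (Set.Ioc (0 : ℝ) 1).indicator (fun a => ENNReal.ofReal (a * phi)) a := by
    intro a
    by_cases ha : a ∈ Set.Ioc (0 : ℝ) 1
    · have e : Prod.mk a ⁻¹' Ω = Set.Ioc (1 - a * phi) 1 := by
        ext b
        simp [Ω, ha.1, ha.2]
      rw [e, Real.volume_Ioc, Set.indicator_of_mem ha]
      congr 1
      ring
    · have e : Prod.mk a ⁻¹' Ω = ∅ := by
        ext b
        simp only [Set.mem_preimage, Ω, Set.mem_ofPred_eq, Set.mem_empty_iff_false, iff_false]
        exact fun h => ha ⟨h.1, h.2.1⟩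
      rw [e, measure_empty, Set.indicator_of_notMem ha]
  rw [Measure.volume_eq_prod, Measure.prod_apply measurableSet_Omega]
  simp_rw [h1]
  rw [lintegral_indicator measurableSet_Ioc, ← ofReal_integral_eq_lintegral_ofReal]
  · rw [← intervalIntegral.integral_of_le zero_le_one, intervalIntegral.integral_mul_const,
      integral_id]
    congr 1
    ring
  · exact ((by fun_prop : Continuous fun a : ℝ => a * phi).integrableOn_Icc).mono_set
      Set.Ioc_subset_Icc_self
  · filter_upwards [ae_restrict_mem measurableSet_Ioc] with a ha
    exact mul_nonneg ha.1.le hphi.le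

lemma volume_real_Omega : volume.real Ω = phi / 2 := by
  rw [measureReal_def, volume_Omega, ENNReal.toReal_ofReal (by linarith [phi_pos])]

lemma volume_Omega_ne_top : volume Ω ≠ ⊤ := by
  rw [volume_Omega]; exact ENNReal.ofReal_ne_top

lemma ae_snd_ne {f : ℝ → ℝ} (hf : Measurable f) : ∀ᵐ p : ℝ × ℝ, p.2 ≠ f p.1 := by
  have hm : MeasurableSet {p : ℝ × ℝ | p.2 = f p.1} :=
    measurableSet_eq_fun measurable_snd (hf.comp measurable_fst)
  have h : (volume : Measure (ℝ × ℝ)) {p : ℝ × ℝ | p.2 = f p.1} = 0 := by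
    rw [Measure.volume_eq_prod, Measure.measure_prod_null hm]
    refine ae_of_all _ fun a => ?_
    have e : Prod.mk a ⁻¹' {p : ℝ × ℝ | p.2 = f p.1} = {f a} := by ext; simp
    simp [e]
  exact measure_eq_zero_iff_ae_notMem.1 h

lemma ae_fst_ne (c : ℝ) : ∀ᵐ p : ℝ × ℝ, p.1 ≠ c := by
  have hm : MeasurableSet {p : ℝ × ℝ | p.1 = c} :=
    measurableSet_eq_fun measurable_fst measurable_const
  have h : (volume : Measure (ℝ × ℝ)) {p : ℝ × ℝ | p.1 = c} = 0 := by
    have e : {p : ℝ × ℝ | p.1 = c} = {c} ×ˢ Set.univ := by ext; simp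
    rw [e, Measure.volume_eq_prod, Measure.prod_prod]
    simp
  exact measure_eq_zero_iff_ae_notMem.1 h

/-- Generic points of `Ω`, at which the return time is continuous. -/
lemma continuousAt_Rfun {p : ℝ × ℝ} (hp : p ∈ interior Ω) (h1 : p.2 ≠ phib - p.1)
    (h2 : p.2 ≠ phib - p.1 * phib) : ContinuousAt Rfun p := by
  have hΩ : ∀ᶠ q in 𝓝 p, q ∈ Ω := mem_interior_iff_mem_nhds.1 hp
  obtain ⟨k1, k2, k3, k4⟩ := hΩ.self_of_nhds
  have hb := phib_bounds
  have hs := phib_sq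
  have hm := phi_mul_phib
  have he := phib_eq
  have c1 : Continuous fun q : ℝ × ℝ => phib - q.1 := by fun_prop
  have c2 : Continuous fun q : ℝ × ℝ => phib - q.1 * phib := by fun_prop
  rcases lt_or_gt_of_ne h1 with h | h
  · have hn : ∀ᶠ q in 𝓝 p, Rfun q = 1 / (q.1 * (q.1 + q.2)) := by
      filter_upwards [hΩ, (continuous_snd.continuousAt.eventually_lt c1.continuousAt h)]
        with q hq hq2
      have : q ∈ Ω₁ := ⟨hq, by nlinarith [hq.2.2.1], hq.2.1, hq.2.2.1, hq2.le⟩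
      simp [Rfun, this]
    have : 0 < p.1 + p.2 := by nlinarith
    refine ContinuousAt.congr ?_ (hn.mono fun q hq => hq.symm)
    fun_prop (disch := positivity)
  · have hn1 := c1.continuousAt.eventually_lt continuous_snd.continuousAt h
    rcases lt_or_gt_of_ne h2 with h' | h'
    · have hn : ∀ᶠ q in 𝓝 p, Rfun q = 1 / (q.1 * (q.1 * phib + q.2)) := by
        filter_upwards [hΩ, hn1, (continuous_snd.continuousAt.eventually_lt c2.continuousAt h')]
          with q hq hq1 hq2
        have e1 : q ∉ Ω₁ := fun hc => absurd hc.2.2.2.2 (not_le.2 hq1)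
        have e2 : q ∈ Ωphi := ⟨hq, by nlinarith [hq.2.2.1], hq.2.1, hq1, hq2.le⟩
        simp [Rfun, e1, e2]
      have : 0 < p.1 * phib + p.2 := by nlinarith
      refine ContinuousAt.congr ?_ (hn.mono fun q hq => hq.symm)
      fun_prop (disch := positivity)
    · have hn : ∀ᶠ q in 𝓝 p, Rfun q = 1 / (q.1 * q.2) := by
        filter_upwards [hΩ, hn1, (c2.continuousAt.eventually_lt continuous_snd.continuousAt h')]
          with q hq hq1 hq2
        have e1 : q ∉ Ω₁ := fun hc => absurd hc.2.2.2.2 (not_le.2 hq1)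
        have e2 : q ∉ Ωphi := fun hc => absurd hc.2.2.2.2 (not_le.2 hq2)
        simp [Rfun, e1, e2]
      have : 0 < p.2 := by nlinarith
      refine ContinuousAt.congr ?_ (hn.mono fun q hq => hq.symm)
      fun_prop (disch := positivity)

lemma isOpen_Omega_open : IsOpen {p : ℝ × ℝ | 0 < p.1 ∧ p.1 < 1 ∧ 1 - p.1 * phi < p.2 ∧ p.2 < 1} :=
  (isOpen_lt (by fun_prop) (by fun_prop)).and ((isOpen_lt (by fun_prop) (by fun_prop)).and
    ((isOpen_lt (by fun_prop) (by fun_prop)).and (isOpen_lt (by fun_prop) (by fun_prop))))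

lemma ae_Rfun_ne (t : ℝ) : ∀ᵐ p : ℝ × ℝ, p ∈ Ω → Rfun p ≠ t := by
  have h1 : ∀ᵐ p : ℝ × ℝ, p.2 ≠ 1 / (t * p.1) := ae_snd_ne (f := fun a => 1 / (t * a)) (by fun_prop)
  have h2 : ∀ᵐ p : ℝ × ℝ, p.2 ≠ 1 / (t * p.1) - p.1 * phib :=
    ae_snd_ne (f := fun a => 1 / (t * a) - a * phib) (by fun_prop)
  have h3 : ∀ᵐ p : ℝ × ℝ, p.2 ≠ 1 / (t * p.1) - p.1 :=
    ae_snd_ne (f := fun a => 1 / (t * a) - a) (by fun_prop)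
  filter_upwards [h1, h2, h3] with p k1 k2 k3 hp ht
  have hR : 1 ≤ Rfun p := one_le_rfun hp
  have hp0 := hp.1
  have key : ∀ x : ℝ, 1 / (p.1 * x) = t → x = 1 / (t * p.1) := by
    intro x hx
    have hx0 : x ≠ 0 := by
      rintro rfl
      rw [mul_zero, div_zero] at hx
      linarith
    rw [← hx]
    field_simp
  unfold Rfun at ht
  split_ifs at ht
  · exact k3 (by linarith [key _ ht])
  · exact k2 (by linarith [key _ ht])
  · exact k1 (key _ ht)

lemma ae_mem_interior (t : ℝ) : ∀ᵐ p : ℝ × ℝ, p ∈ Ω →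
    p ∈ interior {p | p ∈ Ω ∧ t ≤ Rfun p} ∨ p ∈ interior {p | p ∈ Ω ∧ Rfun p < t} := by
  filter_upwards [ae_Rfun_ne t, ae_fst_ne 1, ae_snd_ne (f := fun _ => 1) measurable_const,
    ae_snd_ne (f := fun a => phib - a) (by fun_prop),
    ae_snd_ne (f := fun a => phib - a * phib) (by fun_prop)] with p h1 h2 h3 h4 h5 hp
  have hi : p ∈ interior Ω := by
    refine mem_interior.2 ⟨_, fun q hq => ?_, isOpen_Omega_open, ?_⟩
    · exact ⟨hq.1, hq.2.1.le, hq.2.2.1, hq.2.2.2.le⟩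
    · exact ⟨hp.1, lt_of_le_of_ne hp.2.1 h2, hp.2.2.1, lt_of_le_of_ne hp.2.2.2 h3⟩
  have hc := continuousAt_Rfun hi h4 h5
  have hΩ : ∀ᶠ q in 𝓝 p, q ∈ Ω := mem_interior_iff_mem_nhds.1 hi
  rcases lt_or_gt_of_ne (h1 hp) with h | h
  · right
    rw [mem_interior_iff_mem_nhds]
    filter_upwards [hΩ, hc.eventually_lt_const h] with q a b using ⟨a, b⟩
  · left
    rw [mem_interior_iff_mem_nhds]
    filter_upwards [hΩ, hc.eventually_const_lt h] with q a b using ⟨a, b.le⟩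

lemma volume_real_interior (t : ℝ) :
    volume.real (interior {p | p ∈ Ω ∧ t ≤ Rfun p}) = volume.real {p | p ∈ Ω ∧ t ≤ Rfun p} ∧
    volume.real (interior {p | p ∈ Ω ∧ t ≤ Rfun p}) +
      volume.real (interior {p | p ∈ Ω ∧ Rfun p < t}) = volume.real Ω := by
  set U := interior {p | p ∈ Ω ∧ t ≤ Rfun p}
  set W := interior {p | p ∈ Ω ∧ Rfun p < t}
  have hU : U ⊆ {p | p ∈ Ω ∧ t ≤ Rfun p} := interior_subset
  have hW : W ⊆ {p | p ∈ Ω ∧ Rfun p < t} := interior_subset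
  have hae := ae_mem_interior t
  constructor
  · refine measureReal_congr ?_
    filter_upwards [hae] with p hp
    refine propext ⟨fun h => hU h, fun h => ?_⟩
    exact (hp h.1).resolve_right fun h' => absurd h.2 (not_le.2 (hW h').2)
  · have hUt : volume U ≠ ⊤ := ne_top_of_le_ne_top volume_Omega_ne_top
      (measure_mono fun p hp => (hU hp).1)
    have hWt : volume W ≠ ⊤ := ne_top_of_le_ne_top volume_Omega_ne_top
      (measure_mono fun p hp => (hW hp).1)
    rw [← measureReal_union (Set.disjoint_left.2 fun p h h' =>
      absurd (hU h).2 (not_le.2 (hW h').2)) isOpen_interior.measurableSet hUt hWt]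
    refine measureReal_congr ?_
    filter_upwards [hae] with p hp
    refine propext ⟨fun h => ?_, fun h => hp h⟩
    rcases h with h | h
    · exact (hU h).1
    · exact (hW h).1

lemma m_toReal (t : ℝ) : (m {p | p ∈ Ω ∧ t ≤ Rfun p}).toReal =
    volume.real (interior {p | p ∈ Ω ∧ t ≤ Rfun p}) / volume.real Ω := by
  have hphi := phi_pos
  rw [(volume_real_interior t).1, volume_real_Omega, m, Measure.smul_apply,
    Measure.restrict_apply' measurableSet_Omega, smul_eq_mul, ENNReal.toReal_mul,
    ENNReal.toReal_ofReal (by positivity), Set.inter_eq_self_of_subset_left fun p hp => hp.1,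
    measureReal_def]
  field_simp

/-- A neighbourhood of the identity. -/
def smallSet (η : ℝ) : Set SL2 :=
  coords ⁻¹' ((Set.Ioo (1 - η) (1 + η) ×ˢ Set.Ioo (-η) η) ×ˢ Set.Ioo (-η) η)

lemma measurableSet_smallSet (η : ℝ) : MeasurableSet (smallSet η) :=
  measurable_coords ((measurableSet_Ioo.prod measurableSet_Ioo).prod measurableSet_Ioo)

lemma haarSL_smallSet {η : ℝ} (h1 : η ≤ 1) : haarSL (smallSet η) =
    haarConst * (ENNReal.ofReal (2 * η) * ENNReal.ofReal (2 * η) * ENNReal.ofReal (2 * η)) := by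
  unfold smallSet
  rw [haarSL_preimage_coords
    ((measurableSet_Ioo.prod measurableSet_Ioo).prod measurableSet_Ioo)
    (fun x hx => by linarith [hx.1.1.1]), Measure.volume_eq_prod, Measure.prod_prod,
    Measure.volume_eq_prod, Measure.prod_prod, Real.volume_Ioo, Real.volume_Ioo]
  congr 4 <;> ring

lemma haarSL_smallSet_ne_top {η : ℝ} (h1 : η ≤ 1) : haarSL (smallSet η) ≠ ⊤ := by
  rw [haarSL_smallSet h1]
  exact ENNReal.mul_ne_top haarConst_ne_top (by finiteness)

lemma haarSL_smallSet_ne_zero {η : ℝ} (h0 : 0 < η) (h1 : η ≤ 1) : haarSL (smallSet η) ≠ 0 := by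
  rw [haarSL_smallSet h1]
  simp [haarConst_ne_zero, h0]

lemma smallSet_entries {η : ℝ} (h1 : η ≤ 1 / 10) {o : SL2} (ho : o ∈ smallSet η) :
    |o.1 0 0 - 1| ≤ 2 * η ∧ |o.1 0 1| ≤ 2 * η ∧ |o.1 1 0| ≤ 2 * η ∧ |o.1 1 1 - 1| ≤ 2 * η := by
  obtain ⟨⟨⟨ha1, ha2⟩, hb1, hb2⟩, hc1, hc2⟩ := ho
  simp only [coords] at ha1 ha2 hb1 hb2 hc1 hc2
  have hd := sl2_det o
  generalize o.1 0 0 = a at *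
  generalize o.1 0 1 = b at *
  generalize o.1 1 0 = c at *
  generalize o.1 1 1 = d at *
  have hη : 0 < η := by linarith
  have ha : 0 < a := by linarith
  rw [lt_div_iff₀ ha] at hc1
  rw [div_lt_iff₀ ha] at hc2
  have hc : |c| ≤ 2 * η := abs_le.2 ⟨by nlinarith, by nlinarith⟩
  have hbc : |b * c| ≤ η * (2 * η) := by
    rw [abs_mul]
    exact mul_le_mul (abs_le.2 ⟨hb1.le, hb2.le⟩) hc (abs_nonneg _) hη.le
  obtain ⟨hbc1, hbc2⟩ := abs_le.1 hbc
  refine ⟨abs_le.2 ⟨by linarith, by linarith⟩, abs_le.2 ⟨by linarith, by linarith⟩, hc,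
    abs_le.2 ⟨?_, ?_⟩⟩
  · by_contra! hlt
    nlinarith
  · by_contra! hlt
    nlinarith

/-- The slopes in `[0,1)` of the orbit vectors whose normalized row lies in `L • U`. -/
def slopesIn (L : ℝ) (U : Set (ℝ × ℝ)) : Set ℝ :=
  {σ | (∃ γ ∈ Γ, (γ.1 0 0 / L, γ.1 0 1 / L) ∈ U ∧ σ = γ.1 1 0 / γ.1 0 0) ∧ 0 ≤ σ ∧ σ < 1}

lemma arc_entries {L : ℝ} (hL : L ≠ 0) (o γ : SL2) (s : ℝ) :
    (diagSL L * (o * lowerSL (-s)) * γ).1 0 0 =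
      L⁻¹ * (o.1 0 0 * γ.1 0 0 + o.1 0 1 * (γ.1 1 0 - s * γ.1 0 0)) ∧
    (diagSL L * (o * lowerSL (-s)) * γ).1 0 1 =
      L⁻¹ * (o.1 0 0 * γ.1 0 1 + o.1 0 1 * (γ.1 1 1 - s * γ.1 0 1)) ∧
    (diagSL L * (o * lowerSL (-s)) * γ).1 1 0 =
      L * (o.1 1 0 * γ.1 0 0 + o.1 1 1 * (γ.1 1 0 - s * γ.1 0 0)) := by
  have h := diagSL_entries hL
  refine ⟨?_, ?_, ?_⟩ <;> simp only [sl2_mul, h, lower_entries] <;> ring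

/-- The length of the arc on which a given vector is seen in the unit window. -/
def windowLen (o : SL2) (L : ℝ) : ℝ := 1 / (o.1 1 1 * (L ^ 2 * o.1 1 1 + o.1 0 1))

lemma slope_window {o : SL2} {L t : ℝ} (hd : 0 < o.1 1 1)
    (hdb : 0 < L ^ 2 * o.1 1 1 + o.1 0 1) (hX : 0 < o.1 0 0 + o.1 0 1 * t) :
    (-1 < L ^ 2 * (o.1 1 0 + o.1 1 1 * t) / (o.1 0 0 + o.1 0 1 * t) ∧
      L ^ 2 * (o.1 1 0 + o.1 1 1 * t) / (o.1 0 0 + o.1 0 1 * t) ≤ 0) ↔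
    L ^ 2 * (o.1 1 0 + o.1 1 1 * t) ≤ 0 ∧ -(o.1 1 0 / o.1 1 1) - windowLen o L < t := by
  have hdet := sl2_det o
  unfold windowLen
  generalize o.1 0 0 = a at *
  generalize o.1 0 1 = b at *
  generalize o.1 1 0 = c at *
  generalize o.1 1 1 = d at *
  have e : -(c / d) - 1 / (d * (L ^ 2 * d + b)) = -(L ^ 2 * c + a) / (L ^ 2 * d + b) := by
    obtain ⟨K, hK⟩ : ∃ K, K = L ^ 2 * d + b := ⟨_, rfl⟩
    have hK0 : 0 < K := hK ▸ hdb
    rw [← hK]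
    field_simp
    linear_combination hdet - c * hK
  rw [e, lt_div_iff₀ hX, div_le_iff₀ hX, zero_mul, div_lt_iff₀ hdb, and_comm]
  refine and_congr Iff.rfl ⟨fun h => by linarith, fun h => by linarith⟩

lemma windowLen_bounds {η : ℝ} (h0 : 0 < η) (h1 : η ≤ 1 / 10) {o : SL2} (ho : o ∈ smallSet η)
    {L : ℝ} (hL : 1 ≤ L) : 0 < o.1 1 1 ∧ 0 < L ^ 2 * o.1 1 1 + o.1 0 1 ∧
      1 / ((1 + 2 * η) * (1 + 4 * η)) / L ^ 2 ≤ windowLen o L ∧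
      windowLen o L ≤ 1 / ((1 - 2 * η) * (1 - 4 * η)) / L ^ 2 := by
  obtain ⟨-, hb, -, hd⟩ := smallSet_entries h1 ho
  unfold windowLen
  generalize o.1 0 1 = b at *
  generalize o.1 1 1 = d at *
  rw [abs_le] at hb hd
  have hL2 : 1 ≤ L ^ 2 := one_le_pow₀ hL
  have k1 : L ^ 2 * (1 - 4 * η) ≤ L ^ 2 * d + b := by nlinarith
  have k2 : L ^ 2 * d + b ≤ L ^ 2 * (1 + 4 * η) := by nlinarith
  have k3 : 0 < L ^ 2 * (1 - 4 * η) := by apply mul_pos <;> linarith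
  have hd0 : 0 < d := by linarith
  have k4 : 0 < L ^ 2 * d + b := by linarith
  refine ⟨hd0, k4, ?_, ?_⟩
  · rw [div_div]
    refine one_div_le_one_div_of_le (by positivity) ?_
    calc d * (L ^ 2 * d + b) ≤ (1 + 2 * η) * (L ^ 2 * (1 + 4 * η)) :=
          mul_le_mul (by linarith) k2 k4.le (by linarith)
      _ = _ := by ring
  · rw [div_div]
    refine one_div_le_one_div_of_le ?_ ?_
    · have : 0 < 1 - 2 * η := by linarith
      have : 0 < 1 - 4 * η := by linarith
      positivity
    calc (1 - 2 * η) * (1 - 4 * η) * L ^ 2 = (1 - 2 * η) * (L ^ 2 * (1 - 4 * η)) := by ring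
      _ ≤ _ := mul_le_mul (by linarith) k1 k3.le hd0.le

lemma diag_mul_entries {L : ℝ} (hL : L ≠ 0) (γ : SL2) :
    (diagSL L * γ).1 0 0 = γ.1 0 0 / L ∧ (diagSL L * γ).1 0 1 = γ.1 0 1 / L ∧
    (diagSL L * γ).1 1 0 = L * γ.1 1 0 := by
  have h := diagSL_entries hL
  refine ⟨?_, ?_, ?_⟩ <;> simp only [sl2_mul, h] <;> ring

lemma diag_mul_slope {L : ℝ} (hL : L ≠ 0) (γ : SL2) :
    (diagSL L * γ).1 1 0 / (diagSL L * γ).1 0 0 = L ^ 2 * (γ.1 1 0 / γ.1 0 0) := by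
  rw [(diag_mul_entries hL γ).1, (diag_mul_entries hL γ).2.2]
  field_simp

section Slopes

variable {L : ℝ} {γ δ : SL2}

lemma slope_add_le (hL : 0 < L) (hγ : γ ∈ Γ) (hδ : δ ∈ Γ)
    (h1 : (γ.1 0 0 / L, γ.1 0 1 / L) ∈ Ω) (h2 : (δ.1 0 0 / L, δ.1 0 1 / L) ∈ Ω)
    (h : γ.1 1 0 / γ.1 0 0 < δ.1 1 0 / δ.1 0 0) :
    γ.1 1 0 / γ.1 0 0 + Rfun (γ.1 0 0 / L, γ.1 0 1 / L) / L ^ 2 ≤ δ.1 1 0 / δ.1 0 0 := by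
  obtain ⟨e1, e2, -⟩ := diag_mul_entries hL.ne' γ
  obtain ⟨e3, e4, -⟩ := diag_mul_entries hL.ne' δ
  have hm : diagSL L * γ * (γ⁻¹ * δ) = diagSL L * δ := by group
  rw [← e1, ← e2] at h1 ⊢
  rw [← e3, ← e4] at h2
  have hs := slope_mul (diagSL L * γ) (γ⁻¹ * δ) h1.1.ne' (by rw [hm]; exact h2.1.ne')
  rw [hm, diag_mul_slope hL.ne', diag_mul_slope hL.ne'] at hs
  have hpos : 0 < (diagSL L * γ).1 0 0 * (diagSL L * δ).1 0 0 := mul_pos h1.1 h2.1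
  have hL2 : 0 < L ^ 2 := by positivity
  have hlt := mul_lt_mul_of_pos_left h hL2
  have hq : 0 < (γ⁻¹ * δ).1 1 0 := by
    have : 0 < (γ⁻¹ * δ).1 1 0 / ((diagSL L * γ).1 0 0 * (diagSL L * δ).1 0 0) := by linarith
    exact (div_pos_iff_of_pos_right hpos).1 this
  have := rfun_le_slope_sub (mul_mem (inv_mem hγ) hδ) h1 (by rw [hm]; exact h2) hq
  rw [hm, diag_mul_slope hL.ne', diag_mul_slope hL.ne'] at this
  rw [← le_sub_iff_add_le', div_le_iff₀ hL2]
  linarith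

lemma eq_of_slope_eq (hL : 0 < L) (hγ : γ ∈ Γ) (hδ : δ ∈ Γ)
    (h1 : (γ.1 0 0 / L, γ.1 0 1 / L) ∈ Ω) (h2 : (δ.1 0 0 / L, δ.1 0 1 / L) ∈ Ω)
    (h : γ.1 1 0 / γ.1 0 0 = δ.1 1 0 / δ.1 0 0) : γ = δ := by
  obtain ⟨e1, e2, -⟩ := diag_mul_entries hL.ne' γ
  obtain ⟨e3, e4, -⟩ := diag_mul_entries hL.ne' δ
  have hm : diagSL L * γ * (γ⁻¹ * δ) = diagSL L * δ := by group
  rw [← e1, ← e2] at h1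
  rw [← e3, ← e4] at h2
  have hs := slope_mul (diagSL L * γ) (γ⁻¹ * δ) h1.1.ne' (by rw [hm]; exact h2.1.ne')
  have hpos : 0 < (diagSL L * γ).1 0 0 * (diagSL L * δ).1 0 0 := mul_pos h1.1 h2.1
  rw [hm, diag_mul_slope hL.ne', diag_mul_slope hL.ne', h, left_eq_add, div_eq_zero_iff] at hs
  have := eq_one_of_snd_zero (mul_mem (inv_mem hγ) hδ) h1 (by rw [hm]; exact h2)
    (hs.resolve_right hpos.ne')
  exact inv_mul_eq_one.1 this

lemma exists_slope_next (hL : 0 < L) (hγ : γ ∈ Γ) (h1 : (γ.1 0 0 / L, γ.1 0 1 / L) ∈ Ω) :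
    ∃ δ ∈ Γ, (δ.1 0 0 / L, δ.1 0 1 / L) ∈ Ω ∧
      δ.1 1 0 / δ.1 0 0 = γ.1 1 0 / γ.1 0 0 + Rfun (γ.1 0 0 / L, γ.1 0 1 / L) / L ^ 2 := by
  obtain ⟨e1, e2, -⟩ := diag_mul_entries hL.ne' γ
  rw [← e1, ← e2] at h1 ⊢
  obtain ⟨δ, hδ, h2, h3⟩ := exists_slope_succ h1
  obtain ⟨e3, e4, -⟩ := diag_mul_entries hL.ne' (γ * δ)
  rw [mul_assoc, e3, e4] at h2
  rw [mul_assoc, diag_mul_slope hL.ne', diag_mul_slope hL.ne'] at h3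
  refine ⟨γ * δ, mul_mem hγ hδ, h2, ?_⟩
  have hL2 : L ^ 2 ≠ 0 := by positivity
  apply mul_left_cancel₀ hL2
  rw [h3, mul_add, mul_div_cancel₀ _ hL2]

lemma exists_row_mem (hL : 0 < L) {p q : ℝ} (hv : (p, q) ∈ Λ) (hp : 0 < p) (hpL : p ≤ L) :
    ∃ γ ∈ Γ, γ.1 0 0 = p ∧ γ.1 1 0 = q ∧ (γ.1 0 0 / L, γ.1 0 1 / L) ∈ Ω := by
  have h := diagSL_entries hL.ne'
  have e : (diagSL L).1 0 0 * p + (diagSL L).1 0 1 * q = p / L := by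
    rw [h.1, h.2.1]; ring
  obtain ⟨γ, hγ, h1, h2, -, h3⟩ := exists_mul_row (g := diagSL L) hv (by rw [e]; positivity)
    (by rw [e]; exact (div_le_one hL).2 hpL)
  obtain ⟨e1, e2, -⟩ := diag_mul_entries hL.ne' γ
  rw [e1, e2] at h3
  exact ⟨γ, hγ, h1, h2, h3⟩

end Slopes

lemma mem_SLset_iff {L σ : ℝ} (hL : 0 < L) : σ ∈ SLset L ↔
    (∃ γ ∈ Γ, (γ.1 0 0 / L, γ.1 0 1 / L) ∈ Ω ∧ σ = γ.1 1 0 / γ.1 0 0) ∧ 0 ≤ σ ∧ σ ≤ 1 := by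
  constructor
  · rintro ⟨⟨p, q⟩, hv, h1, h2, h3, h4, rfl⟩
    simp only at h1 h2 h3 h4
    obtain ⟨γ, hγ, rfl, rfl, h⟩ := exists_row_mem hL hv h1 h4
    exact ⟨⟨γ, hγ, h, rfl⟩, div_nonneg h2 h1.le, (div_le_one h1).2 h3⟩
  · rintro ⟨⟨γ, hγ, h, rfl⟩, h0, h1⟩
    have hp : 0 < γ.1 0 0 := (div_pos_iff_of_pos_right hL).1 h.1
    exact ⟨_, col_one_mem hγ, hp, by simpa using (le_div_iff₀ hp).1 h0, (div_le_one hp).1 h1,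
      (div_le_one hL).1 h.2.1, rfl⟩

lemma one_mem_SLset {L : ℝ} (hL : phi ≤ L) : 1 ∈ SLset L := by
  have hphi := phi_pos
  have h : (phi, phi) ∈ Λ := by
    have h1 := shear_mem (rot_mem e1_mem)
    refine orbit_congr (shear_mem (rot_mem h1)) ?_ ?_
    · linear_combination -phi_sq
    · ring
  exact ⟨_, h, hphi, hphi.le, le_rfl, hL, (div_self hphi.ne').symm⟩

lemma slopesIn_subset {L : ℝ} (hL : 0 < L) {U : Set (ℝ × ℝ)} (hU : U ⊆ Ω) :
    slopesIn L U ⊆ SLset L := by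
  rintro σ ⟨⟨γ, hγ, h, e⟩, h0, h1⟩
  exact (mem_SLset_iff hL).2 ⟨⟨γ, hγ, hU h, e⟩, h0, h1.le⟩

lemma finite_SLset {L : ℝ} (hL : 0 < L) : (SLset L).Finite := by
  have hL2 : 0 < L ^ 2 := by positivity
  have hlt : ∀ a ∈ SLset L, ∀ b ∈ SLset L, a < b → ⌊L ^ 2 * a⌋ < ⌊L ^ 2 * b⌋ := by
    intro a ha b hb hab
    obtain ⟨⟨γ, hγ, h1, rfl⟩, -⟩ := (mem_SLset_iff hL).1 ha
    obtain ⟨⟨δ, hδ, h2, rfl⟩, -⟩ := (mem_SLset_iff hL).1 hb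
    have h3 := mul_le_mul_of_nonneg_left (slope_add_le hL hγ hδ h1 h2 hab) hL2.le
    rw [mul_add, mul_div_cancel₀ _ hL2.ne'] at h3
    have := one_le_rfun h1
    rw [Int.lt_iff_add_one_le, Int.le_floor]
    push_cast
    linarith [Int.floor_le (L ^ 2 * (γ.1 1 0 / γ.1 0 0))]
  refine Set.Finite.of_injOn (f := fun a => ⌊L ^ 2 * a⌋) (t := Set.Icc 0 ⌊L ^ 2⌋) ?_ ?_
    (Set.finite_Icc _ _)
  · intro a ha
    obtain ⟨-, h0, h1⟩ := (mem_SLset_iff hL).1 ha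
    exact ⟨Int.floor_nonneg.2 (by positivity), Int.floor_le_floor (by nlinarith)⟩
  · intro a ha b hb hab
    rcases lt_trichotomy a b with h | h | h
    · exact absurd hab (hlt a ha b hb h).ne
    · exact h
    · exact absurd hab (hlt b hb a ha h).ne'

/-- The gap set of the statement. -/
def gapSet (L t : ℝ) : Set (ℝ × ℝ) :=
  {q | q.1 ∈ SLset L ∧ q.2 ∈ SLset L ∧ q.1 < q.2 ∧
    (∀ u ∈ SLset L, ¬(q.1 < u ∧ u < q.2)) ∧ t ≤ L ^ 2 * (q.2 - q.1)}

lemma ncard_gapSet {L : ℝ} (hL : phi ≤ L) (t : ℝ) :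
    (gapSet L t).ncard = (slopesIn L {p | p ∈ Ω ∧ t ≤ Rfun p}).ncard := by
  have hL0 : 0 < L := phi_pos.trans_le hL
  have hL2 : 0 < L ^ 2 := by positivity
  have hinj : Set.InjOn Prod.fst (gapSet L t) := by
    rintro ⟨a, b⟩ ⟨h1, h2, h3, h4, -⟩ ⟨a', b'⟩ ⟨k1, k2, k3, k4, -⟩ (rfl : a = a')
    rcases lt_trichotomy b b' with h | rfl | h
    · exact absurd ⟨h3, h⟩ (k4 b h2)
    · rfl
    · exact absurd ⟨k3, h⟩ (h4 b' k2)
  rw [← hinj.ncard_image]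
  congr 1
  ext σ
  constructor
  · rintro ⟨⟨a, b⟩, ⟨h1, h2, h3, h4, h5⟩, rfl⟩
    simp only at h1 h2 h3 h4 h5 ⊢
    obtain ⟨⟨γ, hγ, g1, rfl⟩, g2, g3⟩ := (mem_SLset_iff hL0).1 h1
    obtain ⟨⟨δ, hδ, k1, rfl⟩, k2, k3⟩ := (mem_SLset_iff hL0).1 h2
    obtain ⟨ε, hε, l1, l2⟩ := exists_slope_next hL0 hγ g1
    have hle := slope_add_le hL0 hγ hδ g1 k1 h3
    have hR := one_le_rfun g1
    have hpos : 0 < Rfun (γ.1 0 0 / L, γ.1 0 1 / L) / L ^ 2 := by positivity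
    have hmem : ε.1 1 0 / ε.1 0 0 ∈ SLset L :=
      (mem_SLset_iff hL0).2 ⟨⟨ε, hε, l1, rfl⟩, by linarith, by linarith⟩
    have hge : δ.1 1 0 / δ.1 0 0 ≤ ε.1 1 0 / ε.1 0 0 := by
      by_contra! hlt
      exact h4 _ hmem ⟨by linarith, hlt⟩
    refine ⟨⟨γ, hγ, ⟨g1, ?_⟩, rfl⟩, g2, h3.trans_le k3⟩
    have : δ.1 1 0 / δ.1 0 0 - γ.1 1 0 / γ.1 0 0 =
      Rfun (γ.1 0 0 / L, γ.1 0 1 / L) / L ^ 2 := by linarith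
    rwa [this, mul_div_cancel₀ _ hL2.ne'] at h5
  · rintro ⟨⟨γ, hγ, ⟨g1, ht⟩, rfl⟩, g2, g3⟩
    obtain ⟨⟨δ, hδ, k1, k2⟩, -⟩ := (mem_SLset_iff hL0).1 (one_mem_SLset hL)
    obtain ⟨ε, hε, l1, l2⟩ := exists_slope_next hL0 hγ g1
    have hle := slope_add_le hL0 hγ hδ g1 k1 (by rwa [← k2])
    have hR := one_le_rfun g1
    have hpos : 0 < Rfun (γ.1 0 0 / L, γ.1 0 1 / L) / L ^ 2 := by positivity
    refine ⟨(_, ε.1 1 0 / ε.1 0 0), ⟨?_, ?_, ?_, fun u hu hc => ?_, ?_⟩, rfl⟩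
    · exact (mem_SLset_iff hL0).2 ⟨⟨γ, hγ, g1, rfl⟩, g2, g3.le⟩
    · exact (mem_SLset_iff hL0).2 ⟨⟨ε, hε, l1, rfl⟩, by linarith, by linarith⟩
    · simp only; linarith
    · obtain ⟨⟨ζ, hζ, z1, rfl⟩, -⟩ := (mem_SLset_iff hL0).1 hu
      have := slope_add_le hL0 hγ hζ g1 z1 hc.1
      linarith [hc.2]
    · simp only
      rw [l2, add_sub_cancel_left, mul_div_cancel₀ _ hL2.ne']
      exact ht

lemma disjoint_slopesIn {L : ℝ} (hL : 0 < L) {U W : Set (ℝ × ℝ)} (hU : U ⊆ Ω) (hW : W ⊆ Ω)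
    (h : Disjoint U W) : Disjoint (slopesIn L U) (slopesIn L W) := by
  refine Set.disjoint_left.2 ?_
  rintro _ ⟨⟨γ, hγ, h1, rfl⟩, -⟩ ⟨⟨δ, hδ, h2, e⟩, -⟩
  have := eq_of_slope_eq hL hγ hδ (hU h1) (hW h2) e
  subst this
  exact Set.disjoint_left.1 h h1 h2

lemma arc_slope_window {o γ : SL2} {L s : ℝ} (hL : 0 < L) (hd : 0 < o.1 1 1)
    (hdb : 0 < L ^ 2 * o.1 1 1 + o.1 0 1) (hx : 0 < γ.1 0 0)
    (hX : 0 < (diagSL L * (o * lowerSL (-s)) * γ).1 0 0) :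
    (-1 < (diagSL L * (o * lowerSL (-s)) * γ).1 1 0 /
        (diagSL L * (o * lowerSL (-s)) * γ).1 0 0 ∧
      (diagSL L * (o * lowerSL (-s)) * γ).1 1 0 /
        (diagSL L * (o * lowerSL (-s)) * γ).1 0 0 ≤ 0) ↔
    s ∈ Set.Ico (γ.1 1 0 / γ.1 0 0 + o.1 1 0 / o.1 1 1)
      (γ.1 1 0 / γ.1 0 0 + o.1 1 0 / o.1 1 1 + windowLen o L) := by
  obtain ⟨e1, -, e3⟩ := arc_entries hL.ne' o γ s
  have ht : o.1 0 0 + o.1 0 1 * (γ.1 1 0 / γ.1 0 0 - s) =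
      (diagSL L * (o * lowerSL (-s)) * γ).1 0 0 * (L / γ.1 0 0) := by
    rw [e1]; field_simp
  have hX' : 0 < o.1 0 0 + o.1 0 1 * (γ.1 1 0 / γ.1 0 0 - s) := by
    rw [ht]; positivity
  have hq : (diagSL L * (o * lowerSL (-s)) * γ).1 1 0 /
      (diagSL L * (o * lowerSL (-s)) * γ).1 0 0 =
      L ^ 2 * (o.1 1 0 + o.1 1 1 * (γ.1 1 0 / γ.1 0 0 - s)) /
        (o.1 0 0 + o.1 0 1 * (γ.1 1 0 / γ.1 0 0 - s)) := by
    rw [ht, e3, div_eq_div_iff hX.ne' (by positivity)]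
    field_simp
  rw [hq, slope_window hd hdb hX', Set.mem_Ico]
  have h1 : o.1 1 0 / o.1 1 1 * o.1 1 1 = o.1 1 0 := div_mul_cancel₀ _ hd.ne'
  have hL2 : 0 < L ^ 2 := by positivity
  refine and_congr ?_ ⟨fun h => by linarith, fun h => by linarith⟩
  rw [← neg_nonneg, ← mul_neg, mul_nonneg_iff_of_pos_left hL2, neg_nonneg]
  constructor
  · intro h
    by_contra! hc
    nlinarith
  · intro h
    nlinarith

lemma arc_inverse {A B C x x' y y' a b c d s S i L : ℝ} (hL : L ≠ 0) (hA : A ≠ 0)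
    (hdγ : x * y' - x' * y = 1) (hdo : a * d - b * c = 1)
    (e1 : A = L⁻¹ * (a * x + b * (y - s * x))) (e2 : B = L⁻¹ * (a * x' + b * (y' - s * x')))
    (e3 : C = L * (c * x + d * (y - s * x))) (hC : C = S * A) (hi : i = 1 / L ^ 2) :
    x / L = d * A - b * (S * A) * i ∧ (y - s * x) / L = a * (S * A) * i - c * A ∧
    x' / L - B = (d - 1) * B - b * (B * S) * i - b * i / A := by
  have hx : x / L = d * A - b * (S * A) * i := by
    rw [hi, ← hC, e1, e3]
    field_simp
    linear_combination -x * hdo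
  refine ⟨hx, ?_, ?_⟩
  · rw [hi, ← hC, e1, e3]
    field_simp
    linear_combination -(y - s * x) * hdo
  · have k : x' * A * L = B * L * x - b := by
      rw [e1, e2]
      field_simp
      linear_combination -b * hdγ
    have k1 : x' / L = (B * (x / L) - b * i) / A := by
      rw [hi]; field_simp; linear_combination k
    rw [k1, hx]
    field_simp
    ring

lemma arc_error_bounds {A B S a b c d i η δ : ℝ} (hδ : 0 < δ) (hη3 : 100 * η ≤ δ * δ) (hη1 : η ≤ 1 / 100)
    (ha : |a - 1| ≤ 2 * η) (hb : |b| ≤ 2 * η) (hc : |c| ≤ 2 * η) (hd : |d - 1| ≤ 2 * η)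
    (hA : δ / 2 ≤ A) (hA0 : 0 < A) (hA1 : A ≤ 1) (hB : |B| ≤ 1) (hS : -1 < S) (hS0 : S ≤ 0)
    (hi0 : 0 ≤ i) (hi1 : i ≤ 1) :
    |(d - 1) * A| ≤ 2 * η ∧ |b * (S * A) * i| ≤ 2 * η ∧ |(d - 1) * B| ≤ 2 * η ∧
    |b * (B * S) * i| ≤ 2 * η ∧ |b * i / A| ≤ δ / 10 ∧ |c * A| ≤ 2 * η ∧
    |a * (S * A) * i| ≤ 2 * i := by
  have hη0 : 0 ≤ η := by linarith [abs_nonneg b]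
  have hS1 : |S| ≤ 1 := abs_le.2 ⟨hS.le, by linarith⟩
  have hA2 : |A| ≤ 1 := by rwa [abs_of_pos hA0]
  have hi2 : |i| ≤ 1 := by rwa [abs_of_nonneg hi0]
  have hSA : |S * A| ≤ 1 := by
    rw [abs_mul]; exact mul_le_one₀ hS1 (abs_nonneg _) hA2
  have hBS : |B * S| ≤ 1 := by
    rw [abs_mul]; exact mul_le_one₀ hB (abs_nonneg _) hS1
  have hm : ∀ u v : ℝ, |u| ≤ 2 * η → |v| ≤ 1 → |u * v| ≤ 2 * η := by
    intro u v hu hv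
    rw [abs_mul]
    calc |u| * |v| ≤ 2 * η * 1 := mul_le_mul hu hv (abs_nonneg _) (by linarith)
      _ = _ := mul_one _
  refine ⟨hm _ _ hd hA2, hm _ _ (hm _ _ hb hSA) hi2, hm _ _ hd hB, hm _ _ (hm _ _ hb hBS) hi2,
    ?_, hm _ _ hc hA2, ?_⟩
  · rw [abs_div, abs_of_pos hA0, div_le_iff₀ hA0]
    have h1 := hm _ _ hb hi2
    have h2 : δ / 10 * (δ / 2) ≤ δ / 10 * A := by gcongr
    linarith
  · have h2 : |a| ≤ 2 := by rw [abs_le] at ha ⊢; constructor <;> linarith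
    rw [abs_mul, abs_mul, abs_of_nonneg hi0]
    exact mul_le_mul_of_nonneg_right ((mul_le_mul h2 hSA (abs_nonneg _) (by norm_num)).trans_eq
      (mul_one _)) hi0

lemma arc_bounds {o γ : SL2} {L s δ ε η : ℝ} (hδ : 0 < δ) (hδ1 : δ ≤ 1) (hε : 0 < ε)
    (hε1 : ε ≤ 1) (hη : η = ε * δ ^ 2 / 100) (ho : o ∈ smallSet η) (hL : 1 ≤ L)
    (hL2 : 16 ≤ ε * δ * L ^ 2)
    (hA : δ / 2 ≤ (diagSL L * (o * lowerSL (-s)) * γ).1 0 0)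
    (hA1 : (diagSL L * (o * lowerSL (-s)) * γ).1 0 0 ≤ 1)
    (hB : |(diagSL L * (o * lowerSL (-s)) * γ).1 0 1| ≤ 1)
    (hS : -1 < (diagSL L * (o * lowerSL (-s)) * γ).1 1 0 /
        (diagSL L * (o * lowerSL (-s)) * γ).1 0 0)
    (hS0 : (diagSL L * (o * lowerSL (-s)) * γ).1 1 0 /
        (diagSL L * (o * lowerSL (-s)) * γ).1 0 0 ≤ 0) :
    |γ.1 0 0 / L - (diagSL L * (o * lowerSL (-s)) * γ).1 0 0| < δ ∧
    |γ.1 0 1 / L - (diagSL L * (o * lowerSL (-s)) * γ).1 0 1| < δ ∧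
    0 < γ.1 0 0 ∧ |γ.1 1 0 - s * γ.1 0 0| < ε * γ.1 0 0 := by
  have hL0 : 0 < L := by linarith
  obtain ⟨e1, e2, e3⟩ := arc_entries hL0.ne' o γ s
  have hη1 : η ≤ 1 / 100 := by
    rw [hη]
    have : ε * δ ^ 2 ≤ 1 := mul_le_one₀ hε1 (by positivity) (pow_le_one₀ hδ.le hδ1)
    linarith
  have hη2 : 100 * η ≤ ε * δ := by
    rw [hη]
    have : ε * δ * δ ≤ ε * δ * 1 := by gcongr
    linarith
  have hη3 : 100 * η ≤ δ * δ := by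
    rw [hη]
    have : ε * (δ * δ) ≤ 1 * (δ * δ) := by gcongr
    linarith
  obtain ⟨ha, hb, hc, hd⟩ := smallSet_entries (hη1.trans (by norm_num)) ho
  have hA0 : 0 < (diagSL L * (o * lowerSL (-s)) * γ).1 0 0 := by linarith
  obtain ⟨hx, hz, hx'⟩ := arc_inverse hL0.ne' hA0.ne' (sl2_det γ) (sl2_det o) e1 e2 e3
    (div_mul_cancel₀ _ hA0.ne').symm rfl
  obtain ⟨i, hi⟩ : ∃ i, i = 1 / L ^ 2 := ⟨_, rfl⟩
  have hi0 : 0 ≤ i := by rw [hi]; positivity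
  have hi1 : i ≤ 1 := by
    rw [hi]; exact div_le_one_of_le₀ (one_le_pow₀ hL) (by positivity)
  have hi2 : 16 * i ≤ ε * δ := by
    rw [hi, mul_one_div, div_le_iff₀ (by positivity)]; exact hL2
  obtain ⟨t1, t2, t3, t4, t5, t6, t7⟩ := arc_error_bounds hδ hη3 hη1 ha hb hc hd hA hA0 hA1
    hB hS hS0 hi0 hi1
  rw [← hi] at hx hz hx'
  have hδε : ε * δ ≤ 1 * δ := by gcongr
  have hδδ : δ * δ ≤ 1 * δ := by gcongr
  rw [abs_le] at t1 t2 t3 t4 t5 t6 t7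
  have hxL : δ / 4 < γ.1 0 0 / L := by rw [hx]; linarith
  have hx0 : 0 < γ.1 0 0 := (div_pos_iff_of_pos_right hL0).1 (by linarith)
  refine ⟨?_, ?_, hx0, ?_⟩
  · rw [hx, abs_lt]; constructor <;> linarith
  · rw [hx', abs_lt]; constructor <;> linarith
  · have k : |(γ.1 1 0 - s * γ.1 0 0) / L| < ε * (γ.1 0 0 / L) := by
      have k1 : ε * (δ / 4) < ε * (γ.1 0 0 / L) := by gcongr
      have k2 : 0 < ε * δ := by positivity
      rw [hz, abs_lt]; constructor <;> linarith
    rw [abs_div, abs_of_pos hL0, ← mul_div_assoc] at k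
    exact (div_lt_div_iff_of_pos_right hL0).1 k

lemma volume_biUnion_Ico_le {S : Set ℝ} (hS : S.Finite) (k w : ℝ) :
    volume (⋃ σ ∈ S, Set.Ico (σ + k) (σ + k + w)) ≤ ENNReal.ofReal (S.ncard * w) := by
  obtain ⟨F, rfl⟩ := hS.exists_finset_coe
  refine (measure_biUnion_finset_le F _).trans ?_
  simp [Set.ncard_coe_finset, ENNReal.ofReal_mul]

/-- The asymptotic density of orbit vectors per unit area of the transversal. -/
def countConst : ℝ := haarConst.toReal / muQX.real Set.univ

lemma abs_snd_le_one {p : ℝ × ℝ} (h : p ∈ Ω) : |p.2| ≤ 1 := by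
  obtain ⟨h1, h2, h3, h4⟩ := h
  have := phi_lt
  exact abs_le.2 ⟨by nlinarith, h4⟩

/-- The measure of the arc parameters meeting the box over `D` is controlled by the number of
slopes in a neighbourhood of `D`. -/
lemma volume_arc_le {D U : Set (ℝ × ℝ)} {δ ε η L : ℝ} (hδ : 0 < δ) (hδ1 : δ ≤ 1) (hε : 0 < ε)
    (hε1 : ε ≤ 1) (hη : η = ε * δ ^ 2 / 100) (hL : 1 ≤ L) (hL2 : 16 ≤ ε * δ * L ^ 2)
    (hU : U ⊆ Ω) (hDU : D ⊆ U) (hDδ : ∀ p ∈ D, δ / 2 ≤ p.1)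
    (hball : ∀ p ∈ D, Metric.ball p δ ⊆ U) {o : SL2} (ho : o ∈ smallSet η) :
    volume ({s | projQX (diagSL L * (o * lowerSL (-s))) ∈ boxClass D} ∩ Set.Icc ε (1 - ε)) ≤
      ENNReal.ofReal ((slopesIn L U).ncard * (1 / ((1 - 2 * η) * (1 - 4 * η)) / L ^ 2)) := by
  have hL0 : 0 < L := by linarith
  have hη0 : 0 < η := by rw [hη]; positivity
  have hη1 : η ≤ 1 / 10 := by
    rw [hη]
    have : ε * δ ^ 2 ≤ 1 := mul_le_one₀ hε1 (by positivity) (pow_le_one₀ hδ.le hδ1)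
    linarith
  obtain ⟨hd, hdb, -, hw⟩ := windowLen_bounds hη0 hη1 ho hL
  have hfin : (slopesIn L U).Finite := (finite_SLset hL0).subset (slopesIn_subset hL0 hU)
  calc _ ≤ volume (⋃ σ ∈ slopesIn L U, Set.Ico (σ + o.1 1 0 / o.1 1 1)
        (σ + o.1 1 0 / o.1 1 1 + windowLen o L)) := measure_mono ?_
    _ ≤ _ := volume_biUnion_Ico_le hfin _ _
    _ ≤ _ := by gcongr
  rintro s ⟨hs, hs1, hs2⟩
  obtain ⟨γ, hγ, ⟨hD, hS⟩⟩ := mem_boxClass.1 hs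
  simp only [coords] at hD hS
  obtain ⟨hS1, hS2⟩ := hS
  have hA := hDδ _ hD
  have hΩ := hU (hDU hD)
  obtain ⟨k1, k2, k3, k4⟩ := arc_bounds hδ hδ1 hε hε1 hη ho hL hL2 hA hΩ.2.1 (abs_snd_le_one hΩ)
    hS1 hS2
  have hw := (arc_slope_window hL0 hd hdb k3 hΩ.1).1 ⟨hS1, hS2⟩
  refine Set.mem_biUnion ⟨⟨γ, hγ, hball _ hD ?_, rfl⟩, ?_, ?_⟩ hw
  · rw [Metric.mem_ball, Prod.dist_eq, max_lt_iff, Real.dist_eq, Real.dist_eq]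
    exact ⟨k1, k2⟩
  · rw [abs_lt] at k4
    apply div_nonneg _ k3.le
    nlinarith
  · rw [abs_lt] at k4
    rw [div_lt_one k3]
    nlinarith

lemma eventually_count_lower {U : Set (ℝ × ℝ)} (hUo : IsOpen U) (hU : U ⊆ Ω) {c : ℝ}
    (hc : c < countConst * volume.real U) :
    ∀ᶠ L : ℝ in atTop, c * L ^ 2 < (slopesIn L U).ncard := by
  have hκ : 0 ≤ countConst := by unfold countConst; positivity
  have hUtop : volume U ≠ ⊤ := ne_top_of_le_ne_top volume_Omega_ne_top (measure_mono hU)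
  obtain ⟨D, hDU, hDc, hD⟩ : ∃ D ⊆ U, IsCompact D ∧ c < countConst * volume.real D := by
    rcases lt_or_ge c 0 with h0 | h0
    · exact ⟨∅, Set.empty_subset _, isCompact_empty, by simpa using h0⟩
    have hκ0 : 0 < countConst := by
      rcases hκ.eq_or_lt with h | h
      · rw [← h, zero_mul] at hc; linarith
      · exact h
    have hr : ENNReal.ofReal (c / countConst) < volume U := by
      rw [← ofReal_measureReal hUtop]
      have : c / countConst < volume.real U := by rwa [div_lt_iff₀' hκ0]
      exact (ENNReal.ofReal_lt_ofReal_iff_of_nonneg (by positivity)).2 this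
    obtain ⟨D, h1, h2, h3⟩ := hUo.exists_lt_isCompact hr
    refine ⟨D, h1, h2, ?_⟩
    rw [← div_lt_iff₀' hκ0]
    have hDtop : volume D ≠ ⊤ := h2.measure_lt_top.ne
    exact (ENNReal.ofReal_lt_iff_lt_toReal (by positivity) hDtop).1 h3
  have hlim : Tendsto (fun ε : ℝ => countConst * volume.real D * (1 - 2 * ε) *
      ((1 - 2 * ε) * (1 - 4 * ε))) (𝓝[>] 0) (𝓝 (countConst * volume.real D)) := by
    have : Continuous fun ε : ℝ => countConst * volume.real D * (1 - 2 * ε) *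
      ((1 - 2 * ε) * (1 - 4 * ε)) := by fun_prop
    have h := this.tendsto 0
    simp only [mul_zero, sub_zero, mul_one] at h
    exact h.mono_left nhdsWithin_le_nhds
  obtain ⟨ε, hε, hε0, hε1⟩ := ((hlim.eventually_const_lt hD).and
    (Ioo_mem_nhdsGT (by norm_num : (0 : ℝ) < 1 / 10))).exists
  obtain ⟨r, hr, hrU⟩ := hDc.exists_thickening_subset_open hUo hDU
  obtain ⟨δ, hδ⟩ : ∃ δ, δ = min r 1 := ⟨_, rfl⟩
  have hδ0 : 0 < δ := hδ ▸ lt_min hr one_pos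
  have hδ1 : δ ≤ 1 := hδ ▸ min_le_right _ _
  have hball : ∀ p ∈ D, Metric.ball p δ ⊆ U := fun p hp =>
    ((Metric.ball_subset_ball (hδ ▸ min_le_left _ _)).trans
      (Metric.ball_subset_thickening hp r)).trans hrU
  have hDδ : ∀ p ∈ D, δ / 2 ≤ p.1 := by
    intro p hp
    have : (p.1 - δ / 2, p.2) ∈ Metric.ball p δ := by
      rw [Metric.mem_ball, Prod.dist_eq, max_lt_iff, Real.dist_eq, Real.dist_eq]
      constructor
      · simp only [sub_sub_cancel_left, abs_neg]
        rw [abs_of_pos] <;> linarith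
      · simpa using hδ0
    have := (hU (hball p hp this)).1
    simp only at this
    linarith
  obtain ⟨η, hη⟩ : ∃ η, η = ε * δ ^ 2 / 100 := ⟨_, rfl⟩
  have hη0 : 0 < η := by rw [hη]; positivity
  have hηε : η ≤ ε := by
    rw [hη]
    have : ε * δ ^ 2 ≤ ε * 1 := by gcongr; exact pow_le_one₀ hδ0.le hδ1
    linarith
  have hDm := hDc.measurableSet
  have p1 : 0 < 1 - 2 * η := by linarith
  have p2 : 0 < 1 - 4 * η := by linarith
  have hbig : ∀ᶠ L : ℝ in atTop, 16 ≤ ε * δ * L ^ 2 :=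
    ((tendsto_pow_atTop two_ne_zero).const_mul_atTop (by positivity)).eventually_ge_atTop 16
  have key := eventually_lt_of_arc_le (O := smallSet η) (I := Set.Icc ε (1 - ε))
    (E := boxClass D)
    (f := fun L => (slopesIn L U).ncard * (1 / ((1 - 2 * η) * (1 - 4 * η)) / L ^ 2))
    (c := c * (1 / ((1 - 2 * η) * (1 - 4 * η))))
    (measurableSet_smallSet η) (haarSL_smallSet_ne_top (by linarith))
    (haarSL_smallSet_ne_zero hη0 (by linarith)) (by simp)
    (measurableSet_boxClass hDm (hDU.trans hU)) ?_ ?_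
  · filter_upwards [key, eventually_ge_atTop 1] with L h1 h2
    have hL2 : 0 < L ^ 2 := by positivity
    obtain ⟨k, hk⟩ : ∃ k, k = 1 / ((1 - 2 * η) * (1 - 4 * η)) := ⟨_, rfl⟩
    have hk0 : 0 < k := by rw [hk]; positivity
    rw [← hk, mul_div_assoc', lt_div_iff₀ hL2, mul_right_comm] at h1
    exact lt_of_mul_lt_mul_right h1 hk0.le
  · filter_upwards [hbig, eventually_ge_atTop 1] with L h1 h2
    refine ⟨by positivity, fun o ho => ?_⟩
    exact volume_arc_le hδ0 hδ1 hε0 (by linarith) hη h2 h1 hU hDU hDδ hball ho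
  · rw [muQX_real_boxClass hDm (hDU.trans hU), mul_div_right_comm, ← countConst,
      mul_one_div, div_lt_iff₀ (by positivity)]
    have hI : volume.real (Set.Icc ε (1 - ε)) = 1 - 2 * ε := by
      rw [Real.volume_real_Icc_of_le (by linarith)]; ring
    rw [hI]
    refine hε.trans_le ?_
    have p3 : 0 < 1 - 2 * ε := by linarith
    have p4 : 0 < 1 - 4 * ε := by linarith
    gcongr

lemma mem_boxSet_of_window {o γ : SL2} {ε η L M s : ℝ} (hη : 0 < η) (hε : ε ≤ 1 / 10)
    (hηε : 10 * η = ε) (ho : o ∈ smallSet η) (hL : 1 ≤ L) (hM : M = (1 + ε) * L)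
    (hM2 : 2 / η ≤ M ^ 2) (hγ : γ ∈ Γ) (hΩ : (γ.1 0 0 / L, γ.1 0 1 / L) ∈ Ω)
    (hs : s ∈ Set.Ico (γ.1 1 0 / γ.1 0 0 + o.1 1 0 / o.1 1 1)
      (γ.1 1 0 / γ.1 0 0 + o.1 1 0 / o.1 1 1 + windowLen o M)) :
    |γ.1 1 0 / γ.1 0 0 - s| ≤ ε ∧ ∃ δ ∈ Γ, δ.1 0 0 = γ.1 0 0 ∧ δ.1 1 0 = γ.1 1 0 ∧
      diagSL M * (o * lowerSL (-s)) * δ ∈ boxSet Ω := by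
  have hL0 : 0 < L := by linarith
  have hM1 : 1 ≤ M := by rw [hM]; nlinarith
  have hM0 : 0 < M := by linarith
  have hx : 0 < γ.1 0 0 := (div_pos_iff_of_pos_right hL0).1 hΩ.1
  have hxL : γ.1 0 0 ≤ L := (div_le_one hL0).1 hΩ.2.1
  obtain ⟨ha, hb, hc, hd⟩ := smallSet_entries (by linarith) ho
  obtain ⟨hd0, hdb, -, hw⟩ := windowLen_bounds hη (by linarith) ho hM1
  have hw2 : windowLen o M ≤ η := by
    refine hw.trans ?_
    rw [div_le_iff₀ hη] at hM2
    rw [div_div]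
    have h1 : 1 / 2 ≤ (1 - 2 * η) * (1 - 4 * η) := by nlinarith
    have h2 : 1 / 2 * M ^ 2 ≤ (1 - 2 * η) * (1 - 4 * η) * M ^ 2 := by gcongr
    rw [div_le_iff₀ (by nlinarith)]
    nlinarith
  have hcd : |o.1 1 0 / o.1 1 1| ≤ 3 * η := by
    rw [abs_div, abs_of_pos hd0, div_le_iff₀ hd0]
    rw [abs_le] at hd
    nlinarith
  have ht : |γ.1 1 0 / γ.1 0 0 - s| ≤ ε := by
    rw [abs_le] at hcd ⊢
    obtain ⟨h1, h2⟩ := hs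
    constructor <;> linarith
  refine ⟨ht, ?_⟩
  obtain ⟨e1, -, e3⟩ := arc_entries hM0.ne' o γ s
  have hX : (diagSL M * (o * lowerSL (-s)) * γ).1 0 0 =
      γ.1 0 0 * (o.1 0 0 + o.1 0 1 * (γ.1 1 0 / γ.1 0 0 - s)) / M := by
    rw [e1]; field_simp
  have hbt : |o.1 0 1 * (γ.1 1 0 / γ.1 0 0 - s)| ≤ 2 * η := by
    rw [abs_mul]
    exact (mul_le_mul hb (ht.trans (by linarith)) (abs_nonneg _) (by linarith)).trans_eq
      (mul_one (2 * η))
  rw [abs_le] at ha hbt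
  have hX0 : 0 < (diagSL M * (o * lowerSL (-s)) * γ).1 0 0 := by
    rw [hX]
    have : 0 < o.1 0 0 + o.1 0 1 * (γ.1 1 0 / γ.1 0 0 - s) := by linarith
    positivity
  have hX1 : (diagSL M * (o * lowerSL (-s)) * γ).1 0 0 ≤ 1 := by
    rw [hX, div_le_one hM0, hM, mul_comm]
    exact mul_le_mul (by linarith) hxL hx.le (by linarith)
  have hS := (arc_slope_window hM0 hd0 hdb hx hX0).2 hs
  have e := sl2_mul (diagSL M * (o * lowerSL (-s))) γ 0 0
  rw [e] at hX0 hX1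
  obtain ⟨δ, hδ, d1, d2, d3, d4⟩ := exists_mul_row (col_one_mem hγ) hX0 hX1
  refine ⟨δ, hδ, d1, d2, d4, ?_⟩
  have f0 : (diagSL M * (o * lowerSL (-s)) * δ).1 0 0 =
      (diagSL M * (o * lowerSL (-s)) * γ).1 0 0 := by rw [e, d3]
  have f1 : (diagSL M * (o * lowerSL (-s)) * δ).1 1 0 =
      (diagSL M * (o * lowerSL (-s)) * γ).1 1 0 := by
    rw [(arc_entries hM0.ne' o δ s).2.2, e3, d1, d2]
  simp only [coords, f0, f1]
  exact hS

lemma le_volume_arc {ε η L M : ℝ} (hη : 0 < η) (hε : ε ≤ 1 / 10)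
    (hηε : 10 * η = ε) (hL : 1 ≤ L) (hM : M = (1 + ε) * L) (hM2 : 2 / η ≤ M ^ 2) {o : SL2}
    (ho : o ∈ smallSet η) :
    ENNReal.ofReal ((SLset L).ncard * (1 / ((1 + 2 * η) * (1 + 4 * η)) / M ^ 2)) ≤
      volume ({s | projQX (diagSL M * (o * lowerSL (-s))) ∈ boxClass Ω} ∩
        Set.Icc (-ε) (1 + ε)) := by
  have hL0 : 0 < L := by linarith
  have hM1 : 1 ≤ M := by rw [hM]; nlinarith
  obtain ⟨-, -, hw, -⟩ := windowLen_bounds hη (by linarith) ho hM1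
  have hfin := finite_SLset hL0
  obtain ⟨F, hF⟩ := hfin.exists_finset_coe
  let J : ℝ → Set ℝ := fun σ => Set.Ico (σ + o.1 1 0 / o.1 1 1)
    (σ + o.1 1 0 / o.1 1 1 + windowLen o M)
  have hmem : ∀ σ ∈ F, ∀ s ∈ J σ, |σ - s| ≤ ε ∧ 0 ≤ σ ∧ σ ≤ 1 ∧
      ∃ δ ∈ Γ, δ.1 1 0 / δ.1 0 0 = σ ∧ diagSL M * (o * lowerSL (-s)) * δ ∈ boxSet Ω := by
    intro σ hσ s hs
    rw [← Finset.mem_coe, hF] at hσ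
    obtain ⟨⟨γ, hγ, hΩ, rfl⟩, h0, h1⟩ := (mem_SLset_iff hL0).1 hσ
    obtain ⟨k, δ, hδ, k1, k2, k3⟩ :=
      mem_boxSet_of_window hη hε hηε ho hL hM hM2 hγ hΩ hs
    exact ⟨k, h0, h1, δ, hδ, by rw [k1, k2], k3⟩
  have hdisj : (F : Set ℝ).PairwiseDisjoint J := by
    intro σ hσ τ hτ hne
    refine Set.disjoint_left.2 fun s hs hs' => hne ?_
    obtain ⟨-, -, -, γ, hγ, rfl, h1⟩ := hmem σ hσ s hs
    obtain ⟨-, -, -, δ, hδ, rfl, h2⟩ := hmem τ hτ s hs'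
    have e : diagSL M * (o * lowerSL (-s)) * γ * (γ⁻¹ * δ) =
      diagSL M * (o * lowerSL (-s)) * δ := by group
    have := fundDom_unique (mul_mem (inv_mem hγ) hδ) (boxSet_subset le_rfl h1)
      (by rw [e]; exact boxSet_subset le_rfl h2)
    rw [inv_mul_eq_one.1 this]
  calc _ ≤ ENNReal.ofReal ((SLset L).ncard * windowLen o M) := by gcongr
    _ = volume (⋃ σ ∈ F, J σ) := by
      rw [measure_biUnion_finset hdisj fun σ _ => measurableSet_Ico, ← hF,
        Set.ncard_coe_finset]
      simp [J, ENNReal.ofReal_mul]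
    _ ≤ _ := measure_mono ?_
  refine Set.iUnion₂_subset fun σ hσ s hs => ?_
  obtain ⟨k, h0, h1, δ, hδ, -, h2⟩ := hmem σ hσ s hs
  refine ⟨mem_boxClass.2 ⟨δ, hδ, h2⟩, ?_⟩
  rw [abs_le] at k
  constructor <;> linarith

lemma eventually_count_upper {c : ℝ} (hc : countConst * volume.real Ω < c) :
    ∀ᶠ L : ℝ in atTop, (SLset L).ncard < c * L ^ 2 := by
  have hκ : 0 ≤ countConst := by unfold countConst; positivity
  have hlim : Tendsto (fun ε : ℝ => countConst * volume.real Ω * (1 + 2 * ε) *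
      ((1 + 2 * ε) * (1 + 4 * ε) * (1 + ε) ^ 2)) (𝓝[>] 0) (𝓝 (countConst * volume.real Ω)) := by
    have : Continuous fun ε : ℝ => countConst * volume.real Ω * (1 + 2 * ε) *
      ((1 + 2 * ε) * (1 + 4 * ε) * (1 + ε) ^ 2) := by fun_prop
    have h := this.tendsto 0
    simp only [mul_zero, add_zero, mul_one, one_pow] at h
    exact h.mono_left nhdsWithin_le_nhds
  obtain ⟨ε, hε, hε0, hε1⟩ := ((hlim.eventually_lt_const hc).and
    (Ioo_mem_nhdsGT (by norm_num : (0 : ℝ) < 1 / 10))).exists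
  obtain ⟨η, hη⟩ : ∃ η, 10 * η = ε := ⟨ε / 10, by ring⟩
  have hη0 : 0 < η := by linarith
  obtain ⟨k, hk⟩ : ∃ k, k = 1 / ((1 + 2 * η) * (1 + 4 * η)) := ⟨_, rfl⟩
  have hk0 : 0 < k := by rw [hk]; positivity
  have hdil : Tendsto (fun L : ℝ => (1 + ε) * L) atTop atTop :=
    tendsto_id.const_mul_atTop (by linarith)
  have hbig : ∀ᶠ M : ℝ in atTop, 2 / η ≤ M ^ 2 :=
    (tendsto_pow_atTop two_ne_zero).eventually_ge_atTop _
  have key := eventually_lt_of_le_arc (O := smallSet η) (I := Set.Icc (-ε) (1 + ε))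
    (E := boxClass Ω) (f := fun M => (SLset (M / (1 + ε))).ncard * (k / M ^ 2))
    (c := c * k / (1 + ε) ^ 2)
    (measurableSet_smallSet η) (haarSL_smallSet_ne_top (by linarith))
    (haarSL_smallSet_ne_zero hη0 (by linarith)) (by simp)
    (measurableSet_boxClass measurableSet_Omega le_rfl) ?_ ?_
  · filter_upwards [hdil.eventually key, eventually_ge_atTop 1] with L h1 h2
    have hε2 : 0 < (1 + ε) ^ 2 := by positivity
    have hL2 : 0 < L ^ 2 := by positivity
    rw [mul_div_cancel_left₀ _ (by linarith), mul_pow, mul_div_assoc', div_lt_div_iff₀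
      (by positivity) hε2] at h1
    refine lt_of_mul_lt_mul_right (a := k * (1 + ε) ^ 2) ?_ (by positivity)
    linarith
  · filter_upwards [hbig, eventually_ge_atTop (1 + ε)] with M h1 h2
    refine ⟨by positivity, fun o ho => ?_⟩
    rw [hk]
    exact le_volume_arc hη0 hε1.le hη ((one_le_div (by linarith)).2 h2)
      (by field_simp) h1 ho
  · rw [muQX_real_boxClass measurableSet_Omega le_rfl, mul_div_right_comm, ← countConst]
    have hI : volume.real (Set.Icc (-ε) (1 + ε)) = 1 + 2 * ε := by
      rw [Real.volume_real_Icc_of_le (by linarith)]; ring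
    rw [hI, hk, mul_one_div, div_div, lt_div_iff₀ (by positivity)]
    refine lt_of_le_of_lt ?_ hε
    have : η ≤ ε := by linarith
    gcongr

lemma countConst_pos : 0 < countConst := by
  have hA : 0 < volume.real Ω := by rw [volume_real_Omega]; linarith [phi_pos]
  have h1 := muQX_real_boxClass measurableSet_Omega le_rfl
  have hc : 0 < haarConst.toReal := ENNReal.toReal_pos haarConst_ne_zero haarConst_ne_top
  have h2 : muQX.real (boxClass Ω) ≤ muQX.real Set.univ := measureReal_mono (Set.subset_univ _)
  unfold countConst
  have : 0 < haarConst.toReal * volume.real Ω := by positivity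
  exact div_pos hc (by linarith)

lemma eventually_ratio_lower {U : Set (ℝ × ℝ)} (hUo : IsOpen U) (hU : U ⊆ Ω) {c : ℝ}
    (hc0 : 0 ≤ c) (hc : c < volume.real U / volume.real Ω) :
    ∀ᶠ L : ℝ in atTop, c * (SLset L).ncard < (slopesIn L U).ncard := by
  have hA : 0 < volume.real Ω := by rw [volume_real_Omega]; linarith [phi_pos]
  have hκ := countConst_pos
  rw [lt_div_iff₀ hA] at hc
  have hlim : Tendsto (fun v : ℝ => c * v) (𝓝[>] (countConst * volume.real Ω))
      (𝓝 (c * (countConst * volume.real Ω))) :=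
    ((continuous_const_mul c).tendsto _).mono_left nhdsWithin_le_nhds
  obtain ⟨v, hv, hv'⟩ := ((hlim.eventually_lt_const
    (show c * (countConst * volume.real Ω) < countConst * volume.real U by nlinarith)).and
    self_mem_nhdsWithin).exists
  filter_upwards [eventually_count_lower hUo hU hv, eventually_count_upper hv'] with L h1 h2
  nlinarith

/-- The sets 𝕊_L are finite, and for every t ≥ 0 the proportion of consecutive gaps of
𝕊_L of (rescaled) size ≥ t converges, as L → ∞, to m({(a,b) ∈ Ω : R(a,b) ≥ t}). -/
theorem golden_L_gap_distribution :
    (∀ L : ℝ, 1 ≤ L → (SLset L).Finite) ∧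
    (∀ t : ℝ, 0 ≤ t →
      Tendsto
        (fun L : ℝ =>
          ((Set.ncard {q : ℝ × ℝ | q.1 ∈ SLset L ∧ q.2 ∈ SLset L ∧ q.1 < q.2 ∧
              (∀ u ∈ SLset L, ¬(q.1 < u ∧ u < q.2)) ∧ t ≤ L ^ 2 * (q.2 - q.1)} : ℝ) /
            ((SLset L).ncard : ℝ)))
        atTop (𝓝 ((m {p : ℝ × ℝ | p ∈ Ω ∧ t ≤ Rfun p}).toReal))) := by
  refine ⟨fun L hL => finite_SLset (by linarith), fun t _ => ?_⟩
  change Tendsto (fun L => ((gapSet L t).ncard : ℝ) / ((SLset L).ncard : ℝ)) atTop _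
  have hA : 0 < volume.real Ω := by rw [volume_real_Omega]; linarith [phi_pos]
  have hsub1 : {p | p ∈ Ω ∧ t ≤ Rfun p} ⊆ Ω := fun p hp => hp.1
  have hsub2 : interior {p | p ∈ Ω ∧ Rfun p < t} ⊆ Ω := interior_subset.trans fun p hp => hp.1
  have hdisj : Disjoint {p | p ∈ Ω ∧ t ≤ Rfun p} (interior {p | p ∈ Ω ∧ Rfun p < t}) :=
    Set.disjoint_left.2 fun p hp hp' => hp.2.not_gt (interior_subset hp').2
  have hpos : ∀ L, phi ≤ L → 0 < (SLset L).ncard := fun L hL =>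
    (Set.ncard_pos (finite_SLset (phi_pos.trans_le hL))).2 ⟨1, one_mem_SLset hL⟩
  rw [m_toReal, tendsto_order]
  constructor
  · intro c hc
    rcases lt_or_ge c 0 with h0 | h0
    · exact Eventually.of_forall fun L => h0.trans_le (by positivity)
    filter_upwards [eventually_ratio_lower isOpen_interior (interior_subset.trans hsub1) h0 hc,
      eventually_ge_atTop phi] with L h1 h2
    have hL := phi_pos.trans_le h2
    have hN : (0 : ℝ) < (SLset L).ncard := Nat.cast_pos.2 (hpos L h2)
    rw [lt_div_iff₀ hN, ncard_gapSet h2]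
    refine h1.trans_le (Nat.cast_le.2 (Set.ncard_le_ncard ?_
      ((finite_SLset hL).subset (slopesIn_subset hL hsub1))))
    rintro σ ⟨⟨γ, hγ, h, e⟩, h'⟩
    exact ⟨⟨γ, hγ, interior_subset h, e⟩, h'⟩
  · intro c hc
    have hle : ∀ L, phi ≤ L → (gapSet L t).ncard +
        (slopesIn L (interior {p | p ∈ Ω ∧ Rfun p < t})).ncard ≤ (SLset L).ncard := by
      intro L h2
      have hL := phi_pos.trans_le h2
      have hf := finite_SLset hL
      have s1 := slopesIn_subset hL hsub1
      have s2 := slopesIn_subset hL hsub2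
      rw [ncard_gapSet h2, ← Set.ncard_union_eq (disjoint_slopesIn hL hsub1 hsub2 hdisj)
        (hf.subset s1) (hf.subset s2)]
      exact Set.ncard_le_ncard (Set.union_subset s1 s2) hf
    rcases lt_or_ge 1 c with h0 | h0
    · filter_upwards [eventually_ge_atTop phi] with L h2
      have hN : (0 : ℝ) < (SLset L).ncard := Nat.cast_pos.2 (hpos L h2)
      have h3 : ((gapSet L t).ncard : ℝ) ≤ (SLset L).ncard :=
        Nat.cast_le.2 ((Nat.le_add_right _ _).trans (hle L h2))
      exact ((div_le_one hN).2 h3).trans_lt h0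
    have hc' : 1 - c < volume.real (interior {p | p ∈ Ω ∧ Rfun p < t}) / volume.real Ω := by
      rw [gt_iff_lt, div_lt_iff₀ hA] at hc
      rw [lt_div_iff₀ hA]
      linarith [(volume_real_interior t).2]
    filter_upwards [eventually_ratio_lower isOpen_interior hsub2 (by linarith) hc',
      eventually_ge_atTop phi] with L h1 h2
    have hN : (0 : ℝ) < (SLset L).ncard := Nat.cast_pos.2 (hpos L h2)
    have h3 : ((gapSet L t).ncard : ℝ) +
        (slopesIn L (interior {p | p ∈ Ω ∧ Rfun p < t})).ncard ≤ (SLset L).ncard := by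
      exact_mod_cast hle L h2
    rw [div_lt_iff₀ hN]
    linarith
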